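/- arXiv:2603.08895 — 12 statements merged into one kernel-verified Lean document; each statement's English description precedes it below -/
import Mathlib

section
/- Let G = K_{p_1,…,p_t} be the complete t-partite graph with t ≥ 2, part sizes p_1 ≥ p_2 ≥ ⋯ ≥ p_t ≥ 1, n = p_1+⋯+p_t, and d_i = n − p_i the common degree of the vertices in the i-th part. Then the characteristic polynomial of the weighted adjacency matrix Ȧ(G) equals x^{n−t} times the characteristic polynomial of the t×t real matrix M defined by m_{ii} = 0 and m_{ij} = p_j·φ(d_i, d_j) for i ≠ j. Equivalently, the spectrum of Ȧ(G) consists of the eigenvalue 0 with multiplicity n − t together with the t eigenvalues of M. -/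
open Polynomial Matrix

/-- The characteristic polynomial of the weighted adjacency matrix of the
complete multipartite graph `K_{p_1,…,p_t}` equals `x^(n-t)` times the characteristic polynomial
of the `t × t` quotient matrix `M` with `m_{ii} = 0` and `m_{ij} = p_j * φ(d_i, d_j)`. -/
theorem weighted_charpoly_complete_multipartite
    (t : ℕ) (ht : 2 ≤ t) (p : Fin t → ℕ) (hp : ∀ i, 1 ≤ p i)
    (hdec : ∀ i j : Fin t, i ≤ j → p j ≤ p i)
    (φ : ℕ → ℕ → ℝ) (hφ : ∀ x y, φ x y = φ y x)
    (n : ℕ) (hn : n = ∑ i, p i)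
    (d : Fin t → ℕ) (hd : ∀ i, d i = n - p i)
    (A : Matrix ((i : Fin t) × Fin (p i)) ((i : Fin t) × Fin (p i)) ℝ)
    (hA : ∀ u v, A u v = if u.1 ≠ v.1 then φ (d u.1) (d v.1) else 0)
    (M : Matrix (Fin t) (Fin t) ℝ)
    (hM : ∀ i j, M i j = if i = j then 0 else (p j : ℝ) * φ (d i) (d j)) :
    A.charpoly = X ^ (n - t) * M.charpoly := by
  let S : Matrix ((i : Fin t) × Fin (p i)) (Fin t) ℝ := fun u i => if u.1 = i then 1 else 0
  let B : Matrix (Fin t) ((i : Fin t) × Fin (p i)) ℝ :=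
    fun i v => if i ≠ v.1 then φ (d i) (d v.1) else 0
  have h1 : A = S * B := by
    ext u v
    rw [hA, Matrix.mul_apply, Finset.sum_eq_single u.1]
    · simp [S, B]
    · intro b _ hb
      simp [S, Ne.symm hb]
    · simp
  have h2 : M = B * S := by
    ext i j
    rw [hM, Matrix.mul_apply, Fintype.sum_sigma, Finset.sum_eq_single j]
    · by_cases h : i = j <;> simp [S, B, h]
    · intro b _ hb
      simp [S, hb]
    · simp
  have hle : Fintype.card (Fin t) ≤ Fintype.card ((i : Fin t) × Fin (p i)) := by
    rw [Fintype.card_sigma]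
    simpa using Finset.sum_le_sum (fun i (_ : i ∈ Finset.univ) => hp i)
  rw [h1, h2, Matrix.charpoly_mul_comm_of_le _ _ hle]
  simp [hn]
end

section
/- Let n ≥ 3 and let K_n − e be the graph obtained from the complete graph K_n by deleting one edge e. Write φ_n = φ(n−1, n−1) and φ_1 = φ(n−2, n−1). Then the characteristic polynomial of Ȧ(K_n − e) equals x·(x + φ_n)^{n−3}·(x² − (n−3)·φ_n·x − 2(n−2)·φ_1²); in particular −φ_n is an eigenvalue with multiplicity n−3, 0 is a simple eigenvalue, and the remaining two eigenvalues are ((n−3)φ_n ± √((n−3)²φ_n² + 8(n−2)φ_1²))/2. -/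
open Polynomial Matrix

lemma aux (m : ℕ) (x p q : ℝ) (hx : x ≠ 0) (hy : x + p ≠ 0)
    (A : Matrix (Fin (m + 3)) (Fin (m + 3)) ℝ)
    (hA : ∀ u v : Fin (m + 3), A u v =
          if (u : ℕ) ≤ 1 then (if (v : ℕ) ≤ 1 then 0 else q)
          else (if (v : ℕ) ≤ 1 then q else if u = v then 0 else p)) :
    (Matrix.scalar (Fin (m + 3)) x - A).det = eval x
      (X * (X + C p) ^ (m + 3 - 3) *
        (X ^ 2 - C ((((m + 3 : ℕ) : ℝ) - 3) * p) * X - C (2 * (((m + 3 : ℕ) : ℝ) - 2) * q ^ 2))) := by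
  let w : Fin (m + 3) → ℝ := fun u => if (u : ℕ) ≤ 1 then x else x + p
  let U : Matrix (Fin (m + 3)) (Fin 2) ℝ :=
    Matrix.of fun u j => if (u : ℕ) ≤ 1 then ![1, 0] j else ![0, 1] j
  let V : Matrix (Fin 2) (Fin (m + 3)) ℝ :=
    Matrix.of fun j u => if (u : ℕ) ≤ 1 then ![0, -q] j else ![-q, -p] j
  have hw : ∀ u, w u ≠ 0 := by
    intro u; simp only [w]; split_ifs <;> assumption
  have hdec : Matrix.scalar (Fin (m + 3)) x - A = Matrix.diagonal w + U * V := by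
    ext u v
    simp only [Matrix.sub_apply, Matrix.add_apply, Matrix.mul_apply, Fin.sum_univ_two, hA,
      Matrix.scalar_apply, Matrix.diagonal_apply, U, V, w, Matrix.of_apply]
    by_cases h : u = v
    · subst h; by_cases h1 : (u : ℕ) ≤ 1 <;> simp [h1]
    · by_cases h1 : (u : ℕ) ≤ 1 <;> by_cases h2 : (v : ℕ) ≤ 1 <;> simp [h1, h2, h]
  have hdet : (Matrix.diagonal w).det = x ^ 2 * (x + p) ^ (m + 1) := by
    rw [Matrix.det_diagonal, Fin.prod_univ_succ, Fin.prod_univ_succ]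
    simp [w]
    ring
  have hinv : (Matrix.diagonal w)⁻¹ = Matrix.diagonal (fun u => (w u)⁻¹) := by
    apply Matrix.inv_eq_right_inv
    rw [Matrix.diagonal_mul_diagonal]
    simp [hw]
  have hsmall : V * (Matrix.diagonal w)⁻¹ * U =
      !![0, -q * (m + 1) / (x + p); -q * 2 / x, -p * (m + 1) / (x + p)] := by
    rw [hinv]
    ext i j
    rw [Matrix.mul_apply]
    simp only [Matrix.mul_diagonal]
    rw [Fin.sum_univ_succ, Fin.sum_univ_succ]
    fin_cases i <;> fin_cases j <;> simp [U, V, w] <;> field_simp <;> ring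
  rw [hdec, Matrix.det_add_mul (A := Matrix.diagonal w), hsmall, hdet, Matrix.det_fin_two]
  · simp
    field_simp
    ring
  · rw [hdet, isUnit_iff_ne_zero]
    positivity

/-- For `n ≥ 3`, the weighted adjacency matrix of `K_n - e` (the edge between
vertices `0` and `1` deleted, so these two vertices have degree `n-2` and all others `n-1`) has
characteristic polynomial `x (x + φ_n)^(n-3) (x² - (n-3)φ_n x - 2(n-2)φ_1²)`; in particular the
two roots of the quadratic factor are `((n-3)φ_n ± √((n-3)²φ_n² + 8(n-2)φ_1²))/2`. -/
theorem weighted_charpoly_complete_graph_minus_edge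
    (n : ℕ) (hn : 3 ≤ n)
    (φ : ℕ → ℕ → ℝ) (hφ : ∀ x y, φ x y = φ y x)
    (d : Fin n → ℕ) (hd : ∀ u, d u = if (u : ℕ) ≤ 1 then n - 2 else n - 1)
    (A : Matrix (Fin n) (Fin n) ℝ)
    (hA : ∀ u v, A u v =
      if u ≠ v ∧ ¬((u : ℕ) = 0 ∧ (v : ℕ) = 1) ∧ ¬((u : ℕ) = 1 ∧ (v : ℕ) = 0)
      then φ (d u) (d v) else 0)
    (φn φ1 : ℝ) (hφn : φn = φ (n - 1) (n - 1)) (hφ1 : φ1 = φ (n - 2) (n - 1)) :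
    A.charpoly =
      X * (X + C φn) ^ (n - 3) *
        (X ^ 2 - C (((n : ℝ) - 3) * φn) * X - C (2 * ((n : ℝ) - 2) * φ1 ^ 2)) ∧
    (X ^ 2 - C (((n : ℝ) - 3) * φn) * X - C (2 * ((n : ℝ) - 2) * φ1 ^ 2)).IsRoot
      ((((n : ℝ) - 3) * φn +
        Real.sqrt (((n : ℝ) - 3) ^ 2 * φn ^ 2 + 8 * ((n : ℝ) - 2) * φ1 ^ 2)) / 2) ∧
    (X ^ 2 - C (((n : ℝ) - 3) * φn) * X - C (2 * ((n : ℝ) - 2) * φ1 ^ 2)).IsRoot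
      ((((n : ℝ) - 3) * φn -
        Real.sqrt (((n : ℝ) - 3) ^ 2 * φn ^ 2 + 8 * ((n : ℝ) - 2) * φ1 ^ 2)) / 2) := by
  have hn3 : (3 : ℝ) ≤ n := by exact_mod_cast hn
  have hS : 0 ≤ ((n : ℝ) - 3) ^ 2 * φn ^ 2 + 8 * ((n : ℝ) - 2) * φ1 ^ 2 := by
    have : 0 ≤ (n : ℝ) - 2 := by linarith
    positivity
  have hsq := Real.sq_sqrt hS
  refine ⟨?_, ?_, ?_⟩
  · apply Polynomial.eq_of_infinite_eval_eq
    apply Set.Infinite.mono (s := ({0, -φn} : Set ℝ)ᶜ)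
    · intro x hx
      simp only [Set.mem_compl_iff, Set.mem_insert_iff, Set.mem_singleton_iff, not_or] at hx
      have hx0 := hx.1
      have hy0 : x + φn ≠ 0 := fun h => hx.2 (by linarith)
      simp only [Set.mem_setOf_eq]
      rw [Matrix.eval_charpoly]
      obtain ⟨m, rfl⟩ : ∃ m, n = m + 3 := ⟨n - 3, by omega⟩
      have hAe : ∀ u v : Fin (m + 3), A u v =
          if (u : ℕ) ≤ 1 then (if (v : ℕ) ≤ 1 then 0 else φ1)
          else (if (v : ℕ) ≤ 1 then φ1 else if u = v then 0 else φn) := by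
        intro u v
        rw [hA, hd, hd, hφn, hφ1]
        have := hφ (m + 3 - 2) (m + 3 - 1)
        simp only [Fin.ext_iff, ne_eq]
        split_ifs <;> first | rfl | (exfalso; omega) | exact this.symm
      exact aux m x φn φ1 hx0 hy0 A hAe
    · exact (Set.toFinite _).infinite_compl
  all_goals
    simp only [IsRoot.def, eval_sub, eval_pow, eval_X, eval_mul, eval_C]
    nlinarith [hsq]
end

section
/- Let n ≥ 3 and let K_n − e be the graph obtained from the complete graph K_n by deleting one edge. Write φ_n = φ(n−1, n−1) and φ_1 = φ(n−2, n−1), and assume φ_n ≥ 0. Then the weighted adjacency energy satisfies Ė_φ(K_n − e) = (n−3)·φ_n + √((n−3)²·φ_n² + 8(n−2)·φ_1²). -/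
open Polynomial Matrix

/-- The energy of a real matrix: the sum of the absolute values of the roots of its
characteristic polynomial, counted with multiplicity. -/
noncomputable def matrixEnergy {m : Type*} [Fintype m] [DecidableEq m]
    (A : Matrix m m ℝ) : ℝ :=
  (A.charpoly.roots.map (fun x => |x|)).sum

lemma charpoly_aux (k : ℕ) (a b : ℝ) (hb : 0 ≤ b) (A : Matrix (Fin (k+3)) (Fin (k+3)) ℝ)
    (hA : ∀ u v, A u v = if (u : ℕ) ≤ 1 then (if (v : ℕ) ≤ 1 then 0 else a)
      else (if (v : ℕ) ≤ 1 then a else if u = v then 0 else b)) :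
    A.charpoly = X * (X + C b) ^ k * (X ^ 2 - C (k * b) * X - C (2 * (k + 1) * a ^ 2)) := by
  apply Polynomial.eq_of_infinite_eval_eq
  apply (Set.Ioi_infinite (0 : ℝ)).mono
  intro x hx
  have hx0 : x ≠ 0 := ne_of_gt hx
  have hxb : x + b ≠ 0 := by
    have : 0 < x := hx
    positivity
  simp only [Set.mem_setOf_eq, Matrix.eval_charpoly]
  let δ : Fin (k+3) → ℝ := fun i => if (i : ℕ) ≤ 1 then x else x + b
  let W : Matrix (Fin (k+3)) (Fin 2) ℝ := Matrix.of fun i =>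
    ![if (i : ℕ) ≤ 1 then 1 / x else 0, if (i : ℕ) ≤ 1 then 0 else 1 / (x + b)]
  let V : Matrix (Fin 2) (Fin (k+3)) ℝ := Matrix.of
    ![fun j => if (j : ℕ) ≤ 1 then 0 else a, fun j => if (j : ℕ) ≤ 1 then a else b]
  have key : Matrix.scalar (Fin (k+3)) x - A = Matrix.diagonal δ * (1 - W * V) := by
    ext i j
    rw [Matrix.diagonal_mul]
    simp only [Matrix.sub_apply, Matrix.scalar_apply, Matrix.diagonal_apply, hA, Matrix.one_apply,
      Matrix.mul_apply, Fin.sum_univ_two, δ, W, V, Matrix.of_apply, Matrix.cons_val_zero,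
      Matrix.cons_val_one]
    by_cases hij : i = j
    · subst hij
      by_cases h1 : (i : ℕ) ≤ 1 <;> simp [h1] <;> field_simp
      ring
    · by_cases h1 : (i : ℕ) ≤ 1 <;> by_cases h2 : (j : ℕ) ≤ 1 <;> simp [h1, h2, hij] <;> field_simp
  rw [key, Matrix.det_mul, Matrix.det_one_sub_mul_comm, Matrix.det_diagonal]
  have hδ : ∏ i, δ i = x ^ 2 * (x + b) ^ (k + 1) := by
    simp [δ, Fin.prod_univ_succ]
    ring
  have hVW : V * W = !![0, (k + 1) * a / (x + b); 2 * a / x, (k + 1) * b / (x + b)] := by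
    ext i j
    fin_cases i <;> fin_cases j <;>
      simp [V, W, Matrix.mul_apply, Fin.sum_univ_succ] <;> ring
  rw [hδ, hVW, Matrix.det_fin_two]
  simp
  field_simp
  ring

/-- For `n ≥ 3` and `φ_n = φ(n-1,n-1) ≥ 0`, `φ_1 = φ(n-2,n-1)`, the weighted
adjacency energy of `K_n - e` equals `(n-3)φ_n + √((n-3)²φ_n² + 8(n-2)φ_1²)`. -/
theorem weighted_energy_complete_graph_minus_edge
    (n : ℕ) (hn : 3 ≤ n)
    (φ : ℕ → ℕ → ℝ) (hφ : ∀ x y, φ x y = φ y x)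
    (d : Fin n → ℕ) (hd : ∀ u, d u = if (u : ℕ) ≤ 1 then n - 2 else n - 1)
    (A : Matrix (Fin n) (Fin n) ℝ)
    (hA : ∀ u v, A u v =
      if u ≠ v ∧ ¬((u : ℕ) = 0 ∧ (v : ℕ) = 1) ∧ ¬((u : ℕ) = 1 ∧ (v : ℕ) = 0)
      then φ (d u) (d v) else 0)
    (φn φ1 : ℝ) (hφn : φn = φ (n - 1) (n - 1)) (hφ1 : φ1 = φ (n - 2) (n - 1))
    (hφnpos : 0 ≤ φn) :
    matrixEnergy A =
      ((n : ℝ) - 3) * φn +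
        Real.sqrt (((n : ℝ) - 3) ^ 2 * φn ^ 2 + 8 * ((n : ℝ) - 2) * φ1 ^ 2) := by
  obtain ⟨k, rfl⟩ : ∃ k, n = k + 3 := ⟨n - 3, by omega⟩
  have hch := charpoly_aux k φ1 φn hφnpos A (by
    intro u v
    rw [hA, hd, hd]
    have := @Fin.ext_iff _ u v
    by_cases h1 : (u : ℕ) ≤ 1 <;> by_cases h2 : (v : ℕ) ≤ 1 <;> simp only [h1, h2, if_true, if_false]
    · rw [if_neg]
      rw [Ne, this]
      omega
    · rw [if_pos, hφ1]
      rw [Ne, this]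
      omega
    · rw [if_pos, hφ1, hφ]
      rw [Ne, this]
      omega
    · by_cases h : u = v
      · simp [h]
      · rw [if_pos, if_neg h, hφn]
        exact ⟨h, by omega, by omega⟩)
  set s := Real.sqrt ((((k + 3 : ℕ) : ℝ) - 3) ^ 2 * φn ^ 2 + 8 * (((k + 3 : ℕ) : ℝ) - 2) * φ1 ^ 2)
    with hs
  have hcast : ((k + 3 : ℕ) : ℝ) = k + 3 := by push_cast; ring
  rw [hcast] at hs ⊢
  have hk : (0 : ℝ) ≤ k := Nat.cast_nonneg k
  have hs2 : s ^ 2 = (k * φn) ^ 2 + 8 * (k + 1) * φ1 ^ 2 := by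
    rw [hs, Real.sq_sqrt]
    · ring
    · have : (k : ℝ) + 3 - 2 = k + 1 := by ring
      rw [this]
      positivity
  have hs0 : 0 ≤ s := Real.sqrt_nonneg _
  have hsk : k * φn ≤ s := by
    apply le_of_sq_le_sq _ hs0
    rw [hs2]
    have : 0 ≤ 8 * ((k : ℝ) + 1) * φ1 ^ 2 := by positivity
    linarith
  have hfac : A.charpoly = (X - C 0) * (X - C (-φn)) ^ k *
      ((X - C ((k * φn + s) / 2)) * (X - C ((k * φn - s) / 2))) := by
    rw [hch]
    have e1 : C (k * φn) = C ((k * φn + s) / 2) + C ((k * φn - s) / 2) := by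
      rw [← C_add]; congr 1; ring
    have e2 : C (2 * (k + 1) * φ1 ^ 2) = - (C ((k * φn + s) / 2) * C ((k * φn - s) / 2)) := by
      rw [← C_mul, ← C_neg]; congr 1; linarith
    rw [e1, e2, C_neg, C_0]
    ring
  have hroots : A.charpoly.roots = {0} + k • {-φn} + ({(k * φn + s) / 2} + {(k * φn - s) / 2}) := by
    have n1 := fun c : ℝ => X_sub_C_ne_zero c
    have n2 := pow_ne_zero k (n1 (-φn))
    rw [hfac, roots_mul (mul_ne_zero (mul_ne_zero (n1 _) n2) (mul_ne_zero (n1 _) (n1 _))),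
      roots_mul (mul_ne_zero (n1 _) n2), roots_mul (mul_ne_zero (n1 _) (n1 _)), roots_pow]
    simp only [roots_X_sub_C]
  rw [matrixEnergy, hroots]
  have hkn : 0 ≤ k * φn := by positivity
  simp only [Multiset.map_add, Multiset.sum_add, Multiset.map_nsmul, Multiset.sum_nsmul,
    Multiset.map_singleton, Multiset.sum_singleton, abs_zero, abs_neg, abs_of_nonneg hφnpos,
    nsmul_eq_mul]
  rw [abs_of_nonneg (by linarith : 0 ≤ (k * φn + s) / 2),
    abs_of_nonpos (by linarith : (k * φn - s) / 2 ≤ 0)]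
  ring
end

section
/- Let n ≥ 3, write φ_n = φ(n−1, n−1) and φ_1 = φ(n−2, n−1), and assume φ_n > 0, φ_1 > 0, and φ_n/φ_1 < √((n−2)/(n−1)). Then the largest eigenvalue (spectral radius) of Ȧ(K_n) is strictly smaller than the largest eigenvalue of Ȧ(K_n − e), i.e., the spectral radius of Ȧ(K_n) decreases relative to that of the edge-deleted graph: λ_1(Ȧ(K_n)) < λ_1(Ȧ(K_n − e)). -/
open Polynomial Matrix

/-- Let `n ≥ 3`, `φ_n = φ(n-1,n-1) > 0`, `φ_1 = φ(n-2,n-1) > 0` with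
`φ_n/φ_1 < √((n-2)/(n-1))`.  Then the largest eigenvalue (spectral radius) of the weighted
adjacency matrix of `K_n` is strictly smaller than that of `K_n - e`. -/
theorem weighted_spectral_radius_decreases
    (n : ℕ) (hn : 3 ≤ n)
    (φ : ℕ → ℕ → ℝ) (hφ : ∀ x y, φ x y = φ y x)
    (AK : Matrix (Fin n) (Fin n) ℝ)
    (hAK : ∀ u v, AK u v = if u ≠ v then φ (n - 1) (n - 1) else 0)
    (d : Fin n → ℕ) (hd : ∀ u, d u = if (u : ℕ) ≤ 1 then n - 2 else n - 1)
    (Ae : Matrix (Fin n) (Fin n) ℝ)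
    (hAe : ∀ u v, Ae u v =
      if u ≠ v ∧ ¬((u : ℕ) = 0 ∧ (v : ℕ) = 1) ∧ ¬((u : ℕ) = 1 ∧ (v : ℕ) = 0)
      then φ (d u) (d v) else 0)
    (φn φ1 : ℝ) (hφn : φn = φ (n - 1) (n - 1)) (hφ1 : φ1 = φ (n - 2) (n - 1))
    (hφnpos : 0 < φn) (hφ1pos : 0 < φ1)
    (hratio : φn / φ1 < Real.sqrt (((n : ℝ) - 2) / ((n : ℝ) - 1))) :
    sSup (spectrum ℝ AK) < sSup (spectrum ℝ Ae) := by
  subst hφn hφ1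
  obtain ⟨k, rfl⟩ : ∃ k, n = k + 3 := ⟨n - 3, by omega⟩
  have e1 : k + 3 - 1 = k + 2 := rfl
  have e2 : k + 3 - 2 = k + 1 := rfl
  simp only [e1, e2] at *
  have hk : (0 : ℝ) ≤ k := Nat.cast_nonneg k
  have hsym : φ (k + 2) (k + 1) = φ (k + 1) (k + 2) := hφ _ _
  generalize hp : φ (k + 2) (k + 2) = p at *
  generalize hq : φ (k + 1) (k + 2) = q at *
  -- the ratio hypothesis, squared
  have hr : ((k : ℝ) + 2) * p ^ 2 < (k + 1) * q ^ 2 := by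
    have h1 := (Real.lt_sqrt (by positivity)).1 hratio
    push_cast at h1
    have e3 : (k : ℝ) + 3 - 2 = k + 1 := by ring
    have e4 : (k : ℝ) + 3 - 1 = k + 2 := by ring
    rw [e3, e4, div_pow, div_lt_div_iff₀ (by positivity) (by positivity)] at h1
    linarith
  -- the eigenvalue of the edge-deleted graph
  obtain ⟨μ, hμ, hμlt⟩ : ∃ μ : ℝ, μ ^ 2 = k * p * μ + 2 * (k + 1) * q ^ 2 ∧ (k + 2) * p < μ := by
    set D : ℝ := (k * p) ^ 2 + 8 * (k + 1) * q ^ 2 with hD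
    have hD0 : 0 ≤ D := by positivity
    refine ⟨(k * p + Real.sqrt D) / 2, ?_, ?_⟩
    · have := Real.sq_sqrt hD0
      nlinarith
    · have : (k + 4) * p < Real.sqrt D := by
        apply Real.lt_sqrt_of_sq_lt
        nlinarith
      linarith
  have hμ0 : 0 < μ := lt_of_le_of_lt (by positivity) hμlt
  have hmem : μ ∈ spectrum ℝ Ae := by
    rw [← Matrix.spectrum_toLin']
    apply Module.End.HasEigenvalue.mem_spectrum
    apply Module.End.hasEigenvalue_of_hasEigenvector
      (x := fun u : Fin (k + 3) => if (u : ℕ) ≤ 1 then (k + 1) * q else μ)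
    rw [Module.End.hasEigenvector_iff, Module.End.mem_eigenspace_iff]
    have n0 : ∀ x : Fin (k + 1), (0 : Fin (k + 3)) ≠ x.succ.succ := fun x h => by
      simpa using congrArg Fin.val h
    have n1 : ∀ x : Fin (k + 1), (1 : Fin (k + 3)) ≠ x.succ.succ := fun x h => by
      simpa using congrArg Fin.val h
    constructor
    · rw [Matrix.toLin'_apply]
      funext u
      simp only [Matrix.mulVec, dotProduct, Pi.smul_apply, smul_eq_mul]
      rw [Fin.sum_univ_succ, Fin.sum_univ_succ]
      refine Fin.cases ?_ (fun u => Fin.cases ?_ (fun u => ?_) u) u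
      · simp [hAe, hd, hq, n0, n1]
        ring
      · simp [hAe, hd, hq, n0, n1]
        ring
      · have : ∀ i : Fin (k + 1), Ae u.succ.succ i.succ.succ = p - if u = i then p else 0 := by
          intro i
          by_cases h : u = i <;> simp [hAe, hd, hp, h]
        simp [this, sub_mul, Finset.sum_sub_distrib]
        simp [hAe, hd, hsym, (n0 _).symm, (n1 _).symm]
        linarith
    · intro h
      have := congrFun h (Fin.last (k + 2))
      simp at this
      exact hμ0.ne' this
  have hle : sSup (spectrum ℝ AK) ≤ (k + 2) * p := by
    apply Real.sSup_le _ (by positivity)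
    intro x hx
    rw [← Matrix.spectrum_toLin', ← Module.End.hasEigenvalue_iff_mem_spectrum] at hx
    obtain ⟨j, hj⟩ := eigenvalue_mem_ball hx
    rw [mem_closedBall_iff_norm] at hj
    have e : ∑ i ∈ Finset.univ.erase j, ‖AK j i‖ = (k + 2) * p := by
      rw [Finset.sum_congr rfl (g := fun _ => p)]
      · simp
      · intro i hi
        rw [hAK, if_pos (Finset.ne_of_mem_erase hi).symm, Real.norm_of_nonneg hφnpos.le]
    rw [e, hAK] at hj
    simp at hj
    exact (le_abs_self x).trans hj
  have hbdd : BddAbove (spectrum ℝ Ae) := (Matrix.finite_spectrum Ae).bddAbove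
  exact hle.trans_lt (hμlt.trans_le (le_csSup hbdd hmem))
end

section
/- Let n ≥ 3, write φ_n = φ(n−1, n−1) and φ_1 = φ(n−2, n−1), and assume φ_n > 0, φ_1 > 0, and φ_n/φ_1 < √((n−2)/(n−1)). Then the weighted adjacency energies satisfy Ė_φ(K_n) < Ė_φ(K_n − e). -/
open Polynomial Matrix

def cls (m : ℕ) : Fin (m + 3) → Fin 3 := Fin.cons 0 (Fin.cons 1 (fun _ => 2))

noncomputable def clsMat (m : ℕ) : Matrix (Fin (m + 3)) (Fin 3) ℝ :=
  Matrix.of fun u i => if cls m u = i then 1 else 0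

lemma clsMat_gram (m : ℕ) :
    (clsMat m)ᵀ * clsMat m = Matrix.diagonal ![1, 1, (m : ℝ) + 1] := by
  ext i j
  rw [Matrix.mul_apply, Fin.sum_univ_succ, Fin.sum_univ_succ]
  fin_cases i <;> fin_cases j <;> simp [clsMat, cls]

lemma clsMat_conj (m : ℕ) (B : Matrix (Fin 3) (Fin 3) ℝ) (u v : Fin (m + 3)) :
    (clsMat m * (B * (clsMat m)ᵀ)) u v = B (cls m u) (cls m v) := by
  simp [clsMat, Matrix.mul_apply]

lemma charpoly_cls (m : ℕ) (B : Matrix (Fin 3) (Fin 3) ℝ) (a : ℝ)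
    (A : Matrix (Fin (m + 3)) (Fin (m + 3)) ℝ)
    (h : ∀ u v, A u v = B (cls m u) (cls m v) - if u = v then a else 0) :
    A.charpoly = (X + C a) ^ m *
      (B * Matrix.diagonal ![1, 1, (m : ℝ) + 1]).charpoly.comp (X + C a) := by
  have hA : A = clsMat m * (B * (clsMat m)ᵀ) - Matrix.scalar _ a := by
    ext u v
    rw [Matrix.sub_apply, clsMat_conj, h]
    simp [Matrix.diagonal_apply]
  rw [hA, Matrix.charpoly_sub_scalar, Matrix.charpoly_mul_comm_of_le _ _ (by simp),
    Matrix.mul_assoc, clsMat_gram]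
  simp

lemma energy_K (m : ℕ) (a : ℝ) (ha : 0 < a)
    (A : Matrix (Fin (m + 3)) (Fin (m + 3)) ℝ)
    (h : ∀ u v, A u v = if u ≠ v then a else 0) :
    matrixEnergy A = 2 * (m + 2) * a := by
  have C2 : (C 2 : ℝ[X]) = 2 := rfl
  have C3 : (C 3 : ℝ[X]) = 3 := rfl
  have hc : A.charpoly = (X - C (-a)) ^ (m + 2) * (X - C ((m + 2) * a)) := by
    rw [charpoly_cls m (Matrix.of fun _ _ => a) a A
      (by intro u v; rw [h]; by_cases huv : u = v <;> simp [huv])]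
    have : (Matrix.of (fun _ _ => a) * Matrix.diagonal ![1, 1, (m : ℝ) + 1] :
        Matrix (Fin 3) (Fin 3) ℝ).charpoly = X ^ 2 * (X - C ((m + 3) * a)) := by
      rw [Matrix.charpoly, Matrix.det_fin_three]
      simp
      rw [C3]
      ring
    rw [this]
    simp
    rw [C3, C2]
    ring
  have hm : |(m : ℝ) + 2| = m + 2 := abs_of_pos (by positivity)
  rw [matrixEnergy, hc, roots_mul (mul_ne_zero (pow_ne_zero _ (X_sub_C_ne_zero _))
    (X_sub_C_ne_zero _)), roots_pow, roots_X_sub_C, roots_X_sub_C]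
  simp [Multiset.map_nsmul, Multiset.sum_nsmul, abs_of_pos ha, hm, abs_mul]
  ring

lemma energy_Ke (m : ℕ) (a b s : ℝ) (ha : 0 < a) (hb : 0 < b)
    (hs : s = Real.sqrt ((m * a) ^ 2 + 8 * (m + 1) * b ^ 2))
    (A : Matrix (Fin (m + 3)) (Fin (m + 3)) ℝ)
    (h : ∀ u v, A u v = !![a, 0, b; 0, a, b; b, b, a] (cls m u) (cls m v)
      - if u = v then a else 0) :
    matrixEnergy A = m * a + s := by
  have hs2 : s ^ 2 = (m * a) ^ 2 + 8 * (m + 1) * b ^ 2 := by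
    rw [hs, Real.sq_sqrt (by positivity)]
  have hs0 : 0 ≤ s := hs ▸ Real.sqrt_nonneg _
  have hsm : m * a ≤ s := by
    rw [hs]; exact Real.le_sqrt_of_sq_le (le_add_of_nonneg_right (by positivity))
  have hma : 0 ≤ m * a := by positivity
  have hc : A.charpoly = (X - C (-a)) ^ m *
      ((X - C 0) * ((X - C ((m * a + s) / 2)) * (X - C ((m * a - s) / 2)))) := by
    rw [charpoly_cls m _ a A h]
    have : (!![a, 0, b; 0, a, b; b, b, a] * Matrix.diagonal ![1, 1, (m : ℝ) + 1] :
        Matrix (Fin 3) (Fin 3) ℝ).charpoly = (X - C a) *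
          ((X - C a) * (X - C ((m + 1) * a)) - C (2 * (m + 1) * b ^ 2)) := by
      have hB : (!![a, 0, b; 0, a, b; b, b, a] * Matrix.diagonal ![1, 1, (m : ℝ) + 1] :
          Matrix (Fin 3) (Fin 3) ℝ) =
          !![a, 0, b * (m + 1); 0, a, b * (m + 1); b, b, a * (m + 1)] := by
        ext i j
        rw [Matrix.mul_diagonal]
        fin_cases i <;> fin_cases j <;> simp
      have C2 : (C 2 : ℝ[X]) = 2 := rfl
      rw [hB, Matrix.charpoly, Matrix.det_fin_three]
      simp
      rw [C2]
      ring
    have h2 : (X - C ((m * a + s) / 2)) * (X - C ((m * a - s) / 2)) =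
        X * (X - C (m * a)) - C (2 * (m + 1) * b ^ 2) := by
      have e1 : (2 * (m + 1) * b ^ 2 : ℝ) = - (((m * a + s) / 2) * ((m * a - s) / 2)) := by
        linarith
      have e2 : (m * a : ℝ) = (m * a + s) / 2 + (m * a - s) / 2 := by ring
      rw [e1]
      conv_rhs => rw [e2]
      simp only [C_add, C_neg, C_mul]
      ring
    rw [this, h2]
    simp
    left
    ring
  have q : ∀ x : ℝ, (X - C x) ≠ 0 := X_sub_C_ne_zero
  rw [matrixEnergy, hc, roots_mul (mul_ne_zero (pow_ne_zero _ (q _))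
      (mul_ne_zero (q _) (mul_ne_zero (q _) (q _)))),
    roots_mul (mul_ne_zero (q _) (mul_ne_zero (q _) (q _))),
    roots_mul (mul_ne_zero (q _) (q _)), roots_pow]
  simp only [roots_X_sub_C, Multiset.map_add, Multiset.sum_add, Multiset.map_nsmul,
    Multiset.sum_nsmul, Multiset.map_singleton, Multiset.sum_singleton, abs_neg, abs_zero]
  rw [abs_of_pos ha, abs_of_nonneg (by linarith : 0 ≤ (m * a + s) / 2),
    abs_of_nonpos (by linarith : (m * a - s) / 2 ≤ 0), nsmul_eq_mul]
  ring

/-- Let `n ≥ 3`, `φ_n = φ(n-1,n-1) > 0`, `φ_1 = φ(n-2,n-1) > 0` with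
`φ_n/φ_1 < √((n-2)/(n-1))`.  Then the weighted adjacency energy of `K_n` is strictly smaller
than that of `K_n - e`. -/
theorem weighted_energy_decreases
    (n : ℕ) (hn : 3 ≤ n)
    (φ : ℕ → ℕ → ℝ) (hφ : ∀ x y, φ x y = φ y x)
    (AK : Matrix (Fin n) (Fin n) ℝ)
    (hAK : ∀ u v, AK u v = if u ≠ v then φ (n - 1) (n - 1) else 0)
    (d : Fin n → ℕ) (hd : ∀ u, d u = if (u : ℕ) ≤ 1 then n - 2 else n - 1)
    (Ae : Matrix (Fin n) (Fin n) ℝ)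
    (hAe : ∀ u v, Ae u v =
      if u ≠ v ∧ ¬((u : ℕ) = 0 ∧ (v : ℕ) = 1) ∧ ¬((u : ℕ) = 1 ∧ (v : ℕ) = 0)
      then φ (d u) (d v) else 0)
    (φn φ1 : ℝ) (hφn : φn = φ (n - 1) (n - 1)) (hφ1 : φ1 = φ (n - 2) (n - 1))
    (hφnpos : 0 < φn) (hφ1pos : 0 < φ1)
    (hratio : φn / φ1 < Real.sqrt (((n : ℝ) - 2) / ((n : ℝ) - 1))) :
    matrixEnergy AK < matrixEnergy Ae := by
  obtain ⟨m, rfl⟩ : ∃ m, n = m + 3 := ⟨n - 3, by omega⟩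
  have e1 : m + 3 - 1 = m + 2 := rfl
  have e2 : m + 3 - 2 = m + 1 := rfl
  rw [e1] at hφn hφ1
  rw [e2] at hφ1
  simp only [e1, e2] at hAK hd
  rw [energy_K m φn hφnpos AK (by intro u v; rw [hAK, hφn]),
    energy_Ke m φn φ1 _ hφnpos hφ1pos rfl Ae ?_]
  · have hlt : (m + 2) * φn ^ 2 < (m + 1) * φ1 ^ 2 := by
      have h0 : 0 ≤ φn / φ1 := by positivity
      rw [Real.lt_sqrt h0] at hratio
      push_cast at hratio
      have e3 : ((m : ℝ) + 3 - 2) / (m + 3 - 1) = (m + 1) / (m + 2) := by ring_nf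
      rw [e3, div_pow, div_lt_div_iff₀ (by positivity) (by positivity)] at hratio
      linarith
    have : (m + 4) * φn < Real.sqrt ((m * φn) ^ 2 + 8 * (m + 1) * φ1 ^ 2) := by
      apply Real.lt_sqrt_of_sq_lt
      nlinarith
    linarith
  · intro u v
    rw [hAe, hd, hd]
    refine Fin.cases ?_ (fun u => Fin.cases ?_ (fun u => ?_) u) u <;>
    refine Fin.cases ?_ (fun v => Fin.cases ?_ (fun v => ?_) v) v <;>
    simp [cls, hφn, hφ1]
    · have : (0 : Fin (m + 3)) ≠ v.succ.succ := by
        intro h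
        have h2 := congrArg Fin.val h
        simp at h2
      simp [this]
    · have : (1 : Fin (m + 3)) ≠ v.succ.succ := by
        intro h
        have h2 := congrArg Fin.val h
        simp at h2
      simp [this]
    · exact hφ _ _
    · have : u.succ.succ ≠ (1 : Fin (m + 3)) := by
        intro h
        have h2 := congrArg Fin.val h
        simp at h2
      simpa [this] using hφ _ _
    · split_ifs <;> simp
end

section
/- For every n ≥ 3, the ISI energy of the complete graph strictly decreases upon deletion of an edge: Ė_ISI(K_n) > Ė_ISI(K_n − e). Explicitly, Ė_ISI(K_n) = (n−1)² and Ė_ISI(K_n − e) = (n−3)(n−1)/2 + √((n−3)²(n−1)²/4 + 8(n−2)·((n−1)(n−2)/(2n−3))²), and the former exceeds the latter. -/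
open Polynomial Matrix

def clsI {N : ℕ} (u : Fin N) : Fin 2 := if (u : ℕ) ≤ 1 then 0 else 1

lemma det_aux (m : ℕ) (a b c x : ℝ) (A : Matrix (Fin (m+3)) (Fin (m+3)) ℝ)
    (hA : ∀ u v, A u v = if u = v then 0 else !![c, b; b, a] (clsI u) (clsI v))
    (hc : x + c ≠ 0) (ha : x + a ≠ 0) :
    A.charpoly.eval x =
      (x + c) * (x + a) ^ m * ((x - c) * (x - m * a) - 2 * (m + 1) * b ^ 2) := by
  set D : Matrix (Fin (m+3)) (Fin (m+3)) ℝ :=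
    Matrix.diagonal (fun u => if clsI u = 0 then x + c else x + a) with hD
  set E : Matrix (Fin (m+3)) (Fin (m+3)) ℝ :=
    Matrix.diagonal (fun u => if clsI u = 0 then (x + c)⁻¹ else (x + a)⁻¹) with hE
  set U : Matrix (Fin (m+3)) (Fin 2) ℝ := Matrix.of fun u i => if clsI u = i then 1 else 0 with hU
  set M : Matrix (Fin 2) (Fin 2) ℝ := !![c, b; b, a] with hM
  have hDE : D * E = 1 := by
    rw [hD, hE, Matrix.diagonal_mul_diagonal, ← Matrix.diagonal_one]
    congr 1
    funext u
    split_ifs <;> field_simp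
  have hUMU : ∀ u v, (U * M * Uᵀ) u v = M (clsI u) (clsI v) := by
    intro u v
    simp [Matrix.mul_apply, hU]
  have h1 : Matrix.scalar (Fin (m+3)) x - A = D * (1 - E * U * (M * Uᵀ)) := by
    have : D * (1 - E * U * (M * Uᵀ)) = D - (D * E) * (U * M * Uᵀ) := by
      simp only [Matrix.mul_sub, Matrix.mul_one, Matrix.mul_assoc]
    rw [this, hDE, Matrix.one_mul]
    ext u v
    rw [Matrix.sub_apply, Matrix.sub_apply, hUMU, hA]
    by_cases huv : u = v
    · subst huv
      have : clsI u = 0 ∨ clsI u = 1 := by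
        generalize clsI u = i
        fin_cases i <;> simp
      rcases this with h | h <;> simp [hD, hM, h]
    · simp [hD, huv]
  have h2 : M * Uᵀ * (E * U) = !![c * (2 * (x + c)⁻¹), b * ((m + 1) * (x + a)⁻¹);
      b * (2 * (x + c)⁻¹), a * ((m + 1) * (x + a)⁻¹)] := by
    have : Uᵀ * (E * U) = !![2 * (x + c)⁻¹, 0; 0, (m + 1) * (x + a)⁻¹] := by
      ext i j
      rw [Matrix.mul_apply, Fin.sum_univ_succ, Fin.sum_univ_succ]
      fin_cases i <;> fin_cases j <;>
        simp [hE, hU, Matrix.diagonal_mul, clsI] <;> ring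
    rw [Matrix.mul_assoc, this, hM]
    ext i j
    fin_cases i <;> fin_cases j <;> simp [Matrix.mul_apply]
  have h3 : D.det = (x + c) ^ 2 * (x + a) ^ (m + 1) := by
    rw [hD, Matrix.det_diagonal, Fin.prod_univ_succ, Fin.prod_univ_succ]
    simp [clsI]
    ring
  rw [Matrix.eval_charpoly, h1, Matrix.det_mul, h3, Matrix.det_one_sub_mul_comm, h2,
    Matrix.det_fin_two]
  simp
  field_simp
  ring

lemma energy_aux (m : ℕ) (a b c r s : ℝ) (A : Matrix (Fin (m+3)) (Fin (m+3)) ℝ)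
    (hA : ∀ u v, A u v = if u = v then 0 else !![c, b; b, a] (clsI u) (clsI v))
    (hrs : r + s = c + m * a) (hp : r * s = c * (m * a) - 2 * (m + 1) * b ^ 2) :
    matrixEnergy A = |c| + m * |a| + |r| + |s| := by
  have h : A.charpoly = (X - C (-c)) * (X - C (-a)) ^ m * (X - C r) * (X - C s) := by
    apply Polynomial.eq_of_infinite_eval_eq
    apply Set.Infinite.mono (s := ({-c, -a} : Set ℝ)ᶜ)
    · intro x hx
      simp only [Set.mem_compl_iff, Set.mem_insert_iff, Set.mem_singleton_iff, not_or] at hx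
      have h1 : x + c ≠ 0 := fun h => hx.1 (by linarith)
      have h2 : x + a ≠ 0 := fun h => hx.2 (by linarith)
      rw [Set.mem_setOf_eq, det_aux m a b c x A hA h1 h2]
      simp
      linear_combination (x + c) * (x + a) ^ m * (x * hrs - hp)
    · exact (Set.toFinite _).infinite_compl
  have hne : ∀ t : ℝ, (X - C t) ≠ 0 := fun t => Polynomial.X_sub_C_ne_zero t
  rw [matrixEnergy, h, Polynomial.roots_mul, Polynomial.roots_mul, Polynomial.roots_mul,
    Polynomial.roots_pow]
  · simp only [Polynomial.roots_X_sub_C, Multiset.map_add, Multiset.sum_add, Multiset.map_nsmul,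
      Multiset.sum_nsmul, Multiset.map_singleton, Multiset.sum_singleton, abs_neg, nsmul_eq_mul]
  all_goals simp only [ne_eq, mul_eq_zero, not_or]
  all_goals simp only [hne, not_false_eq_true, pow_ne_zero, and_self, and_true, ne_eq]

/-- For every `n ≥ 3` the ISI energy of the complete graph strictly decreases
upon deletion of an edge: `Ė_ISI(K_n) = (n-1)²`,
`Ė_ISI(K_n - e) = (n-3)(n-1)/2 + √((n-3)²(n-1)²/4 + 8(n-2)((n-1)(n-2)/(2n-3))²)`,
and the former exceeds the latter. -/
theorem ISI_energy_complete_graph_decreases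
    (n : ℕ) (hn : 3 ≤ n)
    (AK : Matrix (Fin n) (Fin n) ℝ)
    (hAK : ∀ u v, AK u v =
      if u ≠ v then ((n : ℝ) - 1) * ((n : ℝ) - 1) / (((n : ℝ) - 1) + ((n : ℝ) - 1)) else 0)
    (d : Fin n → ℕ) (hd : ∀ u, d u = if (u : ℕ) ≤ 1 then n - 2 else n - 1)
    (Ae : Matrix (Fin n) (Fin n) ℝ)
    (hAe : ∀ u v, Ae u v =
      if u ≠ v ∧ ¬((u : ℕ) = 0 ∧ (v : ℕ) = 1) ∧ ¬((u : ℕ) = 1 ∧ (v : ℕ) = 0)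
      then ((d u : ℝ) * (d v : ℝ)) / ((d u : ℝ) + (d v : ℝ)) else 0) :
    matrixEnergy AK = ((n : ℝ) - 1) ^ 2 ∧
    matrixEnergy Ae =
      ((n : ℝ) - 3) * ((n : ℝ) - 1) / 2 +
        Real.sqrt (((n : ℝ) - 3) ^ 2 * ((n : ℝ) - 1) ^ 2 / 4 +
          8 * ((n : ℝ) - 2) *
            (((n : ℝ) - 1) * ((n : ℝ) - 2) / (2 * (n : ℝ) - 3)) ^ 2) ∧
    matrixEnergy Ae < matrixEnergy AK := by
  obtain ⟨m, rfl⟩ : ∃ m, n = m + 3 := ⟨n - 3, by omega⟩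
  have hm : (0 : ℝ) ≤ m := Nat.cast_nonneg m
  have e1 : matrixEnergy AK = (((m + 3 : ℕ) : ℝ) - 1) ^ 2 := by
    rw [energy_aux m (((m : ℝ) + 2) / 2) (((m : ℝ) + 2) / 2) (((m : ℝ) + 2) / 2)
      ((m + 2) * (((m : ℝ) + 2) / 2)) (-(((m : ℝ) + 2) / 2)) AK]
    · rw [abs_neg, abs_of_nonneg (by positivity), abs_of_nonneg (by positivity)]
      push_cast
      ring
    · intro u v
      rw [hAK]
      by_cases huv : u = v
      · simp [huv]
      · have : ∀ i j : Fin 2, !![((m : ℝ) + 2) / 2, ((m : ℝ) + 2) / 2;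
            ((m : ℝ) + 2) / 2, ((m : ℝ) + 2) / 2] i j = ((m : ℝ) + 2) / 2 := by
          intro i j
          fin_cases i <;> fin_cases j <;> simp
        rw [if_pos huv, if_neg huv, this]
        push_cast
        have h2 : (m : ℝ) + 2 ≠ 0 := by positivity
        have h3 : (m : ℝ) + 3 - 1 = m + 2 := by ring
        rw [h3]
        field_simp
        ring
    · ring
    · ring
  set b : ℝ := (((m + 3 : ℕ) : ℝ) - 1) * (((m + 3 : ℕ) : ℝ) - 2) /
    (2 * ((m + 3 : ℕ) : ℝ) - 3) with hb
  have hb' : b = ((m : ℝ) + 2) * (m + 1) / (2 * m + 3) := by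
    rw [hb]; push_cast; congr 1 <;> ring
  set Q : ℝ := (((m + 3 : ℕ) : ℝ) - 3) ^ 2 * (((m + 3 : ℕ) : ℝ) - 1) ^ 2 / 4 +
          8 * (((m + 3 : ℕ) : ℝ) - 2) * b ^ 2 with hQ
  have hQ' : Q = (m * ((m : ℝ) + 2) / 2) ^ 2 + 8 * (m + 1) * b ^ 2 := by
    rw [hQ]; push_cast; ring
  have hQ0 : 0 ≤ Q := by rw [hQ']; positivity
  have hs := Real.sq_sqrt hQ0
  have hle : m * ((m : ℝ) + 2) / 2 ≤ Real.sqrt Q := by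
    apply Real.le_sqrt_of_sq_le
    rw [hQ']
    have : 0 ≤ 8 * ((m : ℝ) + 1) * b ^ 2 := by positivity
    linarith
  have hpos : 0 ≤ m * ((m : ℝ) + 2) / 2 := by positivity
  have e2 : matrixEnergy Ae =
      (((m + 3 : ℕ) : ℝ) - 3) * (((m + 3 : ℕ) : ℝ) - 1) / 2 + Real.sqrt Q := by
    rw [energy_aux m (((m : ℝ) + 2) / 2) b 0
      ((m * ((m : ℝ) + 2) / 2 + Real.sqrt Q) / 2) ((m * ((m : ℝ) + 2) / 2 - Real.sqrt Q) / 2) Ae]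
    · rw [abs_zero, abs_of_nonneg (by positivity), abs_of_nonneg (by positivity),
        abs_of_nonpos (by linarith)]
      push_cast
      ring
    · intro u v
      rw [hAe, hd, hd]
      have h1 : ((m + 3 - 2 : ℕ) : ℝ) = m + 1 := by
        rw [show m + 3 - 2 = m + 1 by omega]; push_cast; ring
      have h2 : ((m + 3 - 1 : ℕ) : ℝ) = m + 2 := by
        rw [show m + 3 - 1 = m + 2 by omega]; push_cast; ring
      by_cases huv : u = v
      · simp [huv]
      have huv' : (u : ℕ) ≠ v := fun h => huv (Fin.ext h)
      rw [if_neg huv]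
      by_cases hu : (u : ℕ) ≤ 1 <;> by_cases hv : (v : ℕ) ≤ 1
      · rw [if_neg (by omega)]
        simp [clsI, hu, hv]
      · rw [if_pos ⟨huv, by omega, by omega⟩, if_pos hu, if_neg hv, h1, h2, hb']
        simp [clsI, hu, hv]
        congr 1 <;> ring
      · rw [if_pos ⟨huv, by omega, by omega⟩, if_neg hu, if_pos hv, h1, h2, hb']
        simp [clsI, hu, hv]
        congr 1 <;> ring
      · rw [if_pos ⟨huv, by omega, by omega⟩, if_neg hu, if_neg hv, h2]
        simp [clsI, hu, hv]
        field_simp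
        ring
    · ring
    · rw [hQ'] at hs ⊢
      linear_combination (-1/4) * hs
  refine ⟨e1, e2, ?_⟩
  rw [e1, e2]
  have hlt : Real.sqrt Q < ((m : ℝ) + 2) * (m + 4) / 2 := by
    rw [Real.sqrt_lt' (by positivity), hQ']
    have hb2 : b < ((m : ℝ) + 2) / 2 := by
      rw [hb', div_lt_div_iff₀ (by positivity) (by positivity)]
      nlinarith
    have hb0 : 0 ≤ b := by rw [hb']; positivity
    have hb3 : b ^ 2 < (((m : ℝ) + 2) / 2) ^ 2 := by gcongr
    have : 8 * ((m : ℝ) + 1) * b ^ 2 < 8 * (m + 1) * (((m : ℝ) + 2) / 2) ^ 2 := by gcongr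
    nlinarith [sq_nonneg ((m : ℝ) + 2)]
  push_cast
  nlinarith
end

section
/- Let p ≥ 2 and let G = K_{p,p,p} − e be obtained from the complete tripartite graph K_{p,p,p} (all parts of size p, all vertices of degree 2p) by deleting one edge e, and set a = 2p(2p−1)/(4p−1). Then the characteristic polynomial of the ISI matrix ISI(G) equals x^{3p−5}·(x² + p(p−1)x − a²(p−1))·c_p(x), where c_p(x) = x³ − ((16p⁴−24p³+9p²−p)/(4p−1)²)·x² − ((32p⁶−46p⁴+26p³−4p²)/(4p−1)²)·x − (32p⁷−64p⁶+40p⁵−8p⁴)/(4p−1)². In particular 0 is an eigenvalue of multiplicity 3p−5, the two simple eigenvalues λ± = p(5p−1−4p² ± √(16p⁴+24p³−95p²+70p−15))/(2(4p−1)) are the roots of the quadratic factor, and the remaining three eigenvalues are the zeros of c_p. -/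
open Polynomial Matrix

def isiCls (q : ℕ) (u : Fin 3 × Fin (q+1)) : Fin 5 :=
  if u.1 = 2 then 4 else if u.1 = 0 then (if u.2 = 0 then 0 else 2)
    else (if u.2 = 0 then 1 else 3)

def isiM (a b : ℝ) : Matrix (Fin 5) (Fin 5) ℝ :=
  !![0, 0, 0, a, a; 0, 0, a, 0, a; 0, a, 0, b, b; a, 0, b, 0, b; a, a, b, b, 0]

def isiN (a b q : ℝ) : Matrix (Fin 5) (Fin 5) ℝ :=
  !![0, 0, 0, a * q, a * (q+1); 0, 0, a*q, 0, a*(q+1); 0, a, 0, b*q, b*(q+1);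
    a, 0, b*q, 0, b*(q+1); a, a, b*q, b*q, 0]

lemma isi_prod (q : ℕ) (a b : ℝ) :
    (Matrix.of fun (i : Fin 5) (v : Fin 3 × Fin (q+1)) => isiM a b i (isiCls q v)) *
    (Matrix.of fun (v : Fin 3 × Fin (q+1)) (j : Fin 5) => if isiCls q v = j then (1:ℝ) else 0)
    = isiN a b q := by
  ext i j
  simp only [Matrix.mul_apply, Matrix.of_apply, Fintype.sum_prod_type, Fin.sum_univ_three,
    Fin.sum_univ_succ (n := q), isiCls]
  fin_cases i <;> fin_cases j <;> simp [isiM, isiN, Fin.succ_ne_zero] <;> ring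

lemma isiN_charpoly (a b q : ℝ) : (isiN a b q).charpoly =
    (X ^ 2 + C (b * q) * X - C (a^2 * q)) *
    (X ^ 3 - C (b*q) * X ^ 2 - C (a^2*q + 2*a^2*(q+1) + 2*b^2*q*(q+1)) * X
      - C (2*a^2*b*q*(q+1))) := by
  have h : (isiN a b q).charmatrix =
    !![X, 0, 0, -(C a * C q), -(C a * (C q+1)); 0, X, -(C a* C q), 0, -(C a*(C q+1));
      0, -C a, X, -(C b* C q), -(C b*(C q+1));
      -C a, 0, -(C b* C q), X, -(C b*(C q+1)); -C a, -C a, -(C b* C q), -(C b*C q), X] := by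
    ext1 i j
    fin_cases i <;> fin_cases j <;> simp [isiN]
  rw [Matrix.charpoly, h]
  simp only [map_add, map_mul, map_pow, map_one, map_ofNat]
  generalize C a = a
  generalize C b = b
  generalize C q = q
  simp [Matrix.det_succ_row_zero, Fin.sum_univ_succ, Fin.succAbove]
  ring

/-- For `p ≥ 2`, the ISI matrix of `K_{p,p,p} - e` (the edge between vertex
`(0,0)` and vertex `(1,0)` deleted, so these endpoints have degree `2p-1` and all other vertices
degree `2p`) has characteristic polynomial
`x^(3p-5) (x² + p(p-1)x - a²(p-1)) c_p(x)` where `a = 2p(2p-1)/(4p-1)` and `c_p` is the stated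
cubic; in particular the two simple eigenvalues
`λ± = p(5p-1-4p² ± √(16p⁴+24p³-95p²+70p-15))/(2(4p-1))` are the roots of the quadratic factor. -/
theorem ISI_charpoly_tripartite_minus_edge
    (p : ℕ) (hp : 2 ≤ p)
    (d : Fin 3 × Fin p → ℕ)
    (hd : ∀ u, d u =
      if ((u.1 : ℕ) = 0 ∧ (u.2 : ℕ) = 0) ∨ ((u.1 : ℕ) = 1 ∧ (u.2 : ℕ) = 0)
      then 2 * p - 1 else 2 * p)
    (A : Matrix (Fin 3 × Fin p) (Fin 3 × Fin p) ℝ)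
    (hA : ∀ u v, A u v =
      if u.1 ≠ v.1 ∧
        ¬((u.1 : ℕ) = 0 ∧ (u.2 : ℕ) = 0 ∧ (v.1 : ℕ) = 1 ∧ (v.2 : ℕ) = 0) ∧
        ¬((u.1 : ℕ) = 1 ∧ (u.2 : ℕ) = 0 ∧ (v.1 : ℕ) = 0 ∧ (v.2 : ℕ) = 0)
      then ((d u : ℝ) * (d v : ℝ)) / ((d u : ℝ) + (d v : ℝ)) else 0)
    (a : ℝ) (ha : a = 2 * (p : ℝ) * (2 * (p : ℝ) - 1) / (4 * (p : ℝ) - 1)) :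
    A.charpoly =
      X ^ (3 * p - 5) *
        (X ^ 2 + C ((p : ℝ) * ((p : ℝ) - 1)) * X - C (a ^ 2 * ((p : ℝ) - 1))) *
        (X ^ 3
          - C ((16 * (p : ℝ) ^ 4 - 24 * (p : ℝ) ^ 3 + 9 * (p : ℝ) ^ 2 - (p : ℝ)) /
              (4 * (p : ℝ) - 1) ^ 2) * X ^ 2
          - C ((32 * (p : ℝ) ^ 6 - 46 * (p : ℝ) ^ 4 + 26 * (p : ℝ) ^ 3 - 4 * (p : ℝ) ^ 2) /
              (4 * (p : ℝ) - 1) ^ 2) * X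
          - C ((32 * (p : ℝ) ^ 7 - 64 * (p : ℝ) ^ 6 + 40 * (p : ℝ) ^ 5 - 8 * (p : ℝ) ^ 4) /
              (4 * (p : ℝ) - 1) ^ 2)) ∧
    (X ^ 2 + C ((p : ℝ) * ((p : ℝ) - 1)) * X - C (a ^ 2 * ((p : ℝ) - 1))).IsRoot
      ((p : ℝ) * (5 * (p : ℝ) - 1 - 4 * (p : ℝ) ^ 2 +
          Real.sqrt (16 * (p : ℝ) ^ 4 + 24 * (p : ℝ) ^ 3 - 95 * (p : ℝ) ^ 2 +
            70 * (p : ℝ) - 15)) / (2 * (4 * (p : ℝ) - 1))) ∧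
    (X ^ 2 + C ((p : ℝ) * ((p : ℝ) - 1)) * X - C (a ^ 2 * ((p : ℝ) - 1))).IsRoot
      ((p : ℝ) * (5 * (p : ℝ) - 1 - 4 * (p : ℝ) ^ 2 -
          Real.sqrt (16 * (p : ℝ) ^ 4 + 24 * (p : ℝ) ^ 3 - 95 * (p : ℝ) ^ 2 +
            70 * (p : ℝ) - 15)) / (2 * (4 * (p : ℝ) - 1))) := by
  have hp' : (2:ℝ) ≤ (p:ℝ) := by exact_mod_cast hp
  have h4 : (4 * (p:ℝ) - 1) ≠ 0 := by linarith
  refine ⟨?_, ?_, ?_⟩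
  · obtain ⟨q, rfl⟩ : ∃ q, p = q + 1 := ⟨p - 1, by omega⟩
    have hfac : A =
        (Matrix.of fun (v : Fin 3 × Fin (q+1)) (j : Fin 5) =>
          if isiCls q v = j then (1:ℝ) else 0) *
        (Matrix.of fun (i : Fin 5) (v : Fin 3 × Fin (q+1)) =>
          isiM a ((q:ℝ)+1) i (isiCls q v)) := by
      ext u v
      rw [hA, hd, hd]
      obtain ⟨u1, u2⟩ := u
      obtain ⟨v1, v2⟩ := v
      have e1 : ((2 * (q + 1) - 1 : ℕ) : ℝ) = 2 * q + 1 := by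
        have : 2 * (q + 1) - 1 = 2 * q + 1 := by omega
        rw [this]; push_cast; ring
      have hq : (0:ℝ) ≤ q := Nat.cast_nonneg q
      have f1 : a = (2 * (q:ℝ) + 1) * (2 * (q + 1)) / (2 * (q:ℝ) + 1 + 2 * (q + 1)) := by
        rw [ha]; push_cast; congr 1 <;> ring
      have f2 : a = (2 * ((q:ℝ) + 1)) * (2 * q + 1) / (2 * ((q:ℝ) + 1) + (2 * q + 1)) := by
        rw [ha]; push_cast; congr 1 <;> ring
      have f3 : (q:ℝ) + 1 = (2 * ((q:ℝ) + 1)) * (2 * (q + 1)) / (2 * ((q:ℝ) + 1) + 2 * (q + 1)) := by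
        field_simp; ring
      simp only [Matrix.mul_apply, Matrix.of_apply, ite_mul, one_mul, zero_mul,
        Finset.sum_ite_eq, Finset.mem_univ, if_true]
      have hz : ∀ w : Fin (q+1), (w : ℕ) = 0 ↔ w = 0 := fun w => by
        rw [Fin.ext_iff]; simp
      simp only [hz]
      by_cases hu : u2 = 0 <;> by_cases hv : v2 = 0 <;> fin_cases u1 <;> fin_cases v1 <;>
        simp [isiCls, isiM, hu, hv, e1] <;>
        first
          | exact f1.symm
          | exact f2.symm
          | exact f3.symm
    rw [hfac, Matrix.charpoly_mul_comm_of_le _ _ (by simp; omega), isi_prod, isiN_charpoly]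
    have hc : Fintype.card (Fin 3 × Fin (q+1)) - Fintype.card (Fin 5) = 3 * (q+1) - 5 := by simp
    rw [hc, mul_assoc (X ^ (3 * (q+1) - 5))]
    push_cast at h4 ha ⊢
    have h2 : (4 * ((q:ℝ) + 1) - 1) ^ 2 ≠ 0 := pow_ne_zero 2 h4
    have haa : a ^ 2 * (4 * ((q:ℝ) + 1) - 1) ^ 2 =
        (2 * ((q:ℝ) + 1) * (2 * ((q:ℝ) + 1) - 1)) ^ 2 := by
      rw [ha, div_pow, div_mul_cancel₀ _ h2]
    rw [← (eq_div_iff h2).2 (show ((q:ℝ) + 1) * q * (4 * ((q:ℝ) + 1) - 1) ^ 2 =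
        16 * ((q:ℝ) + 1) ^ 4 - 24 * ((q:ℝ) + 1) ^ 3 + 9 * ((q:ℝ) + 1) ^ 2 - ((q:ℝ) + 1) by ring),
      ← (eq_div_iff h2).2 (show (a ^ 2 * q + 2 * a ^ 2 * (q + 1) +
          2 * ((q:ℝ) + 1) ^ 2 * q * (q + 1)) * (4 * ((q:ℝ) + 1) - 1) ^ 2 =
        32 * ((q:ℝ) + 1) ^ 6 - 46 * ((q:ℝ) + 1) ^ 4 + 26 * ((q:ℝ) + 1) ^ 3 -
          4 * ((q:ℝ) + 1) ^ 2 by linear_combination (3 * (q:ℝ) + 2) * haa),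
      ← (eq_div_iff h2).2 (show (2 * a ^ 2 * ((q:ℝ) + 1) * q * (q + 1)) *
          (4 * ((q:ℝ) + 1) - 1) ^ 2 =
        32 * ((q:ℝ) + 1) ^ 7 - 64 * ((q:ℝ) + 1) ^ 6 + 40 * ((q:ℝ) + 1) ^ 5 -
          8 * ((q:ℝ) + 1) ^ 4 by linear_combination (2 * ((q:ℝ) + 1) * q * (q + 1)) * haa),
      add_sub_cancel_right]
  all_goals
    have hD : 0 ≤ 16 * (p : ℝ) ^ 4 + 24 * (p : ℝ) ^ 3 - 95 * (p : ℝ) ^ 2 + 70 * (p : ℝ) - 15 := by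
      have e : 16 * (p : ℝ) ^ 4 + 24 * (p : ℝ) ^ 3 - 95 * (p : ℝ) ^ 2 + 70 * (p : ℝ) - 15
        = (4 * (p:ℝ)^2 - 5 * p + 1)^2 + 16 * (2 * (p:ℝ) - 1)^2 * (p - 1) := by ring
      have : 0 ≤ (p:ℝ) - 1 := by linarith
      rw [e]; positivity
    have hs := Real.sq_sqrt hD
    generalize Real.sqrt _ = s at hs ⊢
    simp only [IsRoot.def, eval_sub, eval_add, eval_mul, eval_pow, eval_X, eval_C]
    rw [ha]
    field_simp
    linear_combination ((p:ℝ) ^ 2 / (4 * (p:ℝ) - 1) ^ 2) * hs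
end

section
/- Let p ≥ 2 and G = K_{p,p,p} − e. Then the ISI energy of G equals Ė_ISI(G) = p·√(16p⁴+24p³−95p²+70p−15)/(4p−1) + E_M, where E_M is the sum of the absolute values of the (real) eigenvalues of the 3×3 matrix M with rows (0, 2p(2p−1)(p−1)/(4p−1), 2p²(2p−1)/(4p−1)), (2p(2p−1)/(4p−1), p(p−1), p²), and (4p(2p−1)/(4p−1), 2p(p−1), 0). -/
open Polynomial Matrix

noncomputable def polyE (P : ℝ[X]) : ℝ := (P.roots.map (fun x => |x|)).sum

lemma polyE_mul {P Q : ℝ[X]} (hP : P ≠ 0) (hQ : Q ≠ 0) : polyE (P * Q) = polyE P + polyE Q := by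
  simp [polyE, Polynomial.roots_mul (mul_ne_zero hP hQ)]

lemma polyE_X_pow (k : ℕ) : polyE (X ^ k : ℝ[X]) = 0 := by
  simp [polyE, Multiset.map_nsmul, Multiset.sum_nsmul]

lemma polyE_X_sub (r : ℝ) : polyE (X - C r) = |r| := by
  simp [polyE]

def clsF {p : ℕ} (u : Fin 3 × Fin p) : Fin 5 :=
  if (u.1 : ℕ) = 0 then (if (u.2 : ℕ) = 0 then 0 else 1)
  else if (u.1 : ℕ) = 1 then (if (u.2 : ℕ) = 0 then 2 else 3)
  else 4

noncomputable def BM (a p : ℝ) : Matrix (Fin 5) (Fin 5) ℝ :=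
  !![0, 0, 0, a, a; 0, 0, a, p, p; 0, a, 0, 0, a; a, p, 0, 0, p; a, p, a, p, 0]

noncomputable def QM (a p : ℝ) : Matrix (Fin 5) (Fin 5) ℝ :=
  !![0, 0, 0, a*(p-1), a*p; 0, 0, a, p*(p-1), p*p; 0, a*(p-1), 0, 0, a*p;
    a, p*(p-1), 0, 0, p*p; a, p*(p-1), a, p*(p-1), 0]

noncomputable def M3 (a p : ℝ) : Matrix (Fin 3) (Fin 3) ℝ :=
  !![0, a*(p-1), a*p; a, p*(p-1), p*p; 2*a, 2*(p*(p-1)), 0]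

lemma QM_charpoly (a p r1 r2 : ℝ) (h1 : r1 + r2 = -(p*(p-1))) (h2 : r1 * r2 = -(a^2*(p-1))) :
    (QM a p).charpoly = ((X - C r1) * (X - C r2)) * (M3 a p).charpoly := by
  apply Polynomial.funext
  intro t
  have e : eval t ((X - C r1) * (X - C r2)) = t^2 + p*(p-1)*t - a^2*(p-1) := by
    simp only [eval_mul, eval_sub, eval_X, eval_C]
    linear_combination -t*h1 + h2
  rw [eval_mul, e, Matrix.eval_charpoly, Matrix.eval_charpoly]
  have e5 : Matrix.scalar (Fin 5) t - QM a p = !![t, 0, 0, -(a*(p-1)), -(a*p); 0, t, -a, -(p*(p-1)), -(p*p); 0, -(a*(p-1)), t, 0, -(a*p);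
    -a, -(p*(p-1)), 0, t, -(p*p); -a, -(p*(p-1)), -a, -(p*(p-1)), t] := by
    ext i j; fin_cases i <;> fin_cases j <;> simp [QM]
  have e3 : Matrix.scalar (Fin 3) t - M3 a p = !![t, -(a*(p-1)), -(a*p); -a, t-p*(p-1), -(p*p); -(2*a), -(2*(p*(p-1))), t] := by
    ext i j; fin_cases i <;> fin_cases j <;> simp [M3]
  rw [e5, e3, Matrix.det_fin_three]
  simp [Matrix.det_succ_row_zero, Fin.sum_univ_succ, Fin.succAbove]
  ring

lemma charpoly_aux_s13 {m n : Type*} [Fintype m] [DecidableEq m] [Fintype n] [DecidableEq n]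
    {A : Matrix m m ℝ} {Q : Matrix n n ℝ} {U : Matrix m n ℝ} {V : Matrix n m ℝ}
    (h : A = U * V) (h' : V * U = Q) :
    X ^ Fintype.card n * A.charpoly = X ^ Fintype.card m * Q.charpoly := by
  subst h
  subst h'
  exact Matrix.charpoly_mul_comm' U V

lemma VU_eq (a : ℝ) (q : ℕ) :
    (Matrix.of fun (k : Fin 5) (v : Fin 3 × Fin (q+1)) => BM a ((q+1 : ℕ) : ℝ) k (clsF v)) *
    (Matrix.of fun (v : Fin 3 × Fin (q+1)) (k : Fin 5) => if clsF v = k then (1:ℝ) else 0)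
      = QM a ((q+1 : ℕ) : ℝ) := by
  ext k l
  rw [Matrix.mul_apply, Fintype.sum_prod_type]
  simp only [Fin.sum_univ_succ (n := q), Fin.sum_univ_three, Matrix.of_apply]
  fin_cases k <;> fin_cases l <;> simp [clsF, BM, QM] <;> ring

/-- For `p ≥ 2`, the ISI energy of `K_{p,p,p} - e` equals
`p√(16p⁴+24p³-95p²+70p-15)/(4p-1) + E_M`, where `E_M` is the sum of the absolute values of the
(real) eigenvalues of the displayed `3 × 3` matrix `M`. -/
theorem ISI_energy_tripartite_minus_edge
    (p : ℕ) (hp : 2 ≤ p)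
    (d : Fin 3 × Fin p → ℕ)
    (hd : ∀ u, d u =
      if ((u.1 : ℕ) = 0 ∧ (u.2 : ℕ) = 0) ∨ ((u.1 : ℕ) = 1 ∧ (u.2 : ℕ) = 0)
      then 2 * p - 1 else 2 * p)
    (A : Matrix (Fin 3 × Fin p) (Fin 3 × Fin p) ℝ)
    (hA : ∀ u v, A u v =
      if u.1 ≠ v.1 ∧
        ¬((u.1 : ℕ) = 0 ∧ (u.2 : ℕ) = 0 ∧ (v.1 : ℕ) = 1 ∧ (v.2 : ℕ) = 0) ∧
        ¬((u.1 : ℕ) = 1 ∧ (u.2 : ℕ) = 0 ∧ (v.1 : ℕ) = 0 ∧ (v.2 : ℕ) = 0)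
      then ((d u : ℝ) * (d v : ℝ)) / ((d u : ℝ) + (d v : ℝ)) else 0)
    (M : Matrix (Fin 3) (Fin 3) ℝ)
    (hM : M = !![0, 2 * (p : ℝ) * (2 * (p : ℝ) - 1) * ((p : ℝ) - 1) / (4 * (p : ℝ) - 1),
                    2 * (p : ℝ) ^ 2 * (2 * (p : ℝ) - 1) / (4 * (p : ℝ) - 1);
                 2 * (p : ℝ) * (2 * (p : ℝ) - 1) / (4 * (p : ℝ) - 1),
                    (p : ℝ) * ((p : ℝ) - 1), (p : ℝ) ^ 2;
                 4 * (p : ℝ) * (2 * (p : ℝ) - 1) / (4 * (p : ℝ) - 1),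
                    2 * (p : ℝ) * ((p : ℝ) - 1), 0]) :
    matrixEnergy A =
      (p : ℝ) * Real.sqrt (16 * (p : ℝ) ^ 4 + 24 * (p : ℝ) ^ 3 - 95 * (p : ℝ) ^ 2 +
          70 * (p : ℝ) - 15) / (4 * (p : ℝ) - 1)
        + matrixEnergy M := by
  obtain ⟨q, rfl⟩ : ∃ q, p = q + 1 := ⟨p - 1, by omega⟩
  have hq : (1:ℝ) ≤ q := by exact_mod_cast (by omega : 1 ≤ q)
  set P : ℝ := ((q+1 : ℕ) : ℝ) with hP
  have hPq : P = q + 1 := by rw [hP]; push_cast; ring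
  have hP2 : 2 ≤ P := by linarith
  have h4 : 0 < 4 * P - 1 := by linarith
  obtain ⟨a, ha⟩ : ∃ a, a = 2 * P * (2 * P - 1) / (4 * P - 1) := ⟨_, rfl⟩
  have hMa : M = M3 a P := by
    rw [hM, ha]
    ext i j
    fin_cases i <;> fin_cases j <;> simp [M3] <;> ring
  have hc : ((2 * (q + 1) - 1 : ℕ) : ℝ) = 2 * P - 1 := by
    rw [hPq, show 2 * (q+1) - 1 = 2 * q + 1 by omega]; push_cast; ring
  have hc2 : ((2 * (q + 1) : ℕ) : ℝ) = 2 * P := by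
    rw [hPq]; push_cast; ring
  have w1 : (2 * P - 1) * (2 * P) / (2 * P - 1 + 2 * P) = a := by
    rw [ha]; congr 1 <;> ring
  have w2 : (2 * P) * (2 * P - 1) / (2 * P + (2 * P - 1)) = a := by
    rw [ha]; congr 1; ring
  have w3 : (2 * P) * (2 * P) / (2 * P + 2 * P) = P := by
    field_simp; ring
  have hUV : A = (Matrix.of fun (v : Fin 3 × Fin (q+1)) (k : Fin 5) => if clsF v = k then (1:ℝ) else 0) *
      (Matrix.of fun (k : Fin 5) (v : Fin 3 × Fin (q+1)) => BM a P k (clsF v)) := by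
    ext u v
    rw [Matrix.mul_apply]
    simp only [Matrix.of_apply, ite_mul, one_mul, zero_mul, Finset.sum_ite_eq, Finset.mem_univ, if_true]
    rw [hA, hd u, hd v]
    obtain ⟨i, x⟩ := u
    obtain ⟨j, y⟩ := v
    by_cases hx : (x : ℕ) = 0 <;> by_cases hy : (y : ℕ) = 0 <;> fin_cases i <;> fin_cases j <;>
      simp only [hx, hy, clsF] <;> simp [BM, hc, hc2, w1, w2, w3, -Nat.cast_add, -Nat.cast_mul]
  have hVU := VU_eq a q
  rw [← hP] at hVU
  have key := charpoly_aux_s13 hUV hVU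
  obtain ⟨s, hs⟩ : ∃ s, s = P * Real.sqrt (16 * P ^ 4 + 24 * P ^ 3 - 95 * P ^ 2 +
          70 * P - 15) / (4 * P - 1) := ⟨_, rfl⟩
  have hs0 : 0 ≤ s := by rw [hs]; positivity
  have hrad : 16 * P ^ 4 + 24 * P ^ 3 - 95 * P ^ 2 + 70 * P - 15
      = ((P-1)*(4*P-1))^2 + 16*(2*P-1)^2*(P-1) := by ring
  have hP1 : 0 ≤ P - 1 := by linarith
  have hs2 : s^2 = (P*(P-1))^2 + 4*a^2*(P-1) := by
    have haP : a * (4 * P - 1) = 2 * P * (2 * P - 1) := by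
      rw [ha]; exact div_mul_cancel₀ _ h4.ne'
    rw [hs, div_pow, mul_pow, Real.sq_sqrt (by rw [hrad]; positivity), hrad,
      div_eq_iff (pow_ne_zero 2 h4.ne')]
    linear_combination (-4 * (P - 1)) * (a * (4 * P - 1) + 2 * P * (2 * P - 1)) * haP
  have hb0 : 0 ≤ P*(P-1) := by positivity
  have hbs : P*(P-1) ≤ s := by
    refine le_of_sq_le_sq ?_ hs0
    rw [hs2]
    have : 0 ≤ 4*a^2*(P-1) := by positivity
    linarith
  have hQ := QM_charpoly a P ((-(P*(P-1)) + s)/2) ((-(P*(P-1)) - s)/2) (by ring)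
    (by linear_combination (-1/4) * hs2)
  rw [hQ] at key
  have hX : ∀ k, (X ^ k : ℝ[X]) ≠ 0 := fun k => pow_ne_zero _ X_ne_zero
  have k2 := congrArg polyE key
  rw [polyE_mul (hX _) (Matrix.charpoly_monic _).ne_zero,
    polyE_mul (hX _) (mul_ne_zero (mul_ne_zero (X_sub_C_ne_zero _) (X_sub_C_ne_zero _)) (Matrix.charpoly_monic _).ne_zero),
    polyE_mul (mul_ne_zero (X_sub_C_ne_zero _) (X_sub_C_ne_zero _)) (Matrix.charpoly_monic _).ne_zero,
    polyE_mul (X_sub_C_ne_zero _) (X_sub_C_ne_zero _), polyE_X_pow, polyE_X_pow, polyE_X_sub, polyE_X_sub,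
    abs_of_nonneg (by linarith), abs_of_nonpos (by linarith)] at k2
  rw [← hs, hMa]
  change polyE A.charpoly = s + polyE (M3 a P).charpoly
  linarith
end

section
/- For every p ≥ 3, the ISI energy of the regular complete tripartite graph increases upon deletion of an edge: Ė_ISI(K_{p,p,p} − e) > Ė_ISI(K_{p,p,p}). -/
open Polynomial Matrix

lemma isi_spec {m : Type*} [Fintype m] [DecidableEq m] (A : Matrix m m ℝ) (hA : A.IsHermitian) :
    ∃ (l : m → ℝ) (v : m → m → ℝ), matrixEnergy A = ∑ i, |l i| ∧
      (∀ i, A *ᵥ v i = l i • v i) ∧ (∀ i, v i ⬝ᵥ v i = 1) ∧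
      ∀ N : Matrix m m ℝ, ∑ i, v i ⬝ᵥ (N *ᵥ v i) = N.trace := by
  set U : Matrix m m ℝ := (hA.eigenvectorUnitary : Matrix m m ℝ) with hU
  have h1 : Uᵀ * U = 1 := by
    have := (Matrix.mem_unitaryGroup_iff').1 hA.eigenvectorUnitary.2
    rwa [Matrix.star_eq_conjTranspose, Matrix.conjTranspose_eq_transpose_of_trivial] at this
  have h2 : U * Uᵀ = 1 := mul_eq_one_comm.1 h1
  refine ⟨hA.eigenvalues, fun i => U.col i, ?_, ?_, ?_, ?_⟩
  · unfold matrixEnergy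
    rw [hA.roots_charpoly_eq_eigenvalues]
    simp
  · intro i
    exact hA.mulVec_eigenvectorBasis i
  · intro i
    have := congrFun (congrFun h1 i) i
    simpa [Matrix.mul_apply, dotProduct] using this
  · intro N
    have : (Uᵀ * (N * U)).trace = N.trace := by
      rw [Matrix.trace_mul_comm, Matrix.mul_assoc, h2, Matrix.mul_one]
    rw [← this]
    simp [Matrix.trace, Matrix.mul_apply, dotProduct, Matrix.mulVec]

lemma isi_upper {m : Type*} [Fintype m] [DecidableEq m] (A M : Matrix m m ℝ) (hA : A.IsHermitian)
    (h : ∀ v : m → ℝ, |v ⬝ᵥ (A *ᵥ v)| ≤ v ⬝ᵥ (M *ᵥ v)) : matrixEnergy A ≤ M.trace := by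
  obtain ⟨l, v, hE, hv, h1, hN⟩ := isi_spec A hA
  rw [hE, ← hN M]
  apply Finset.sum_le_sum
  intro i _
  have := h (v i)
  rwa [hv, dotProduct_smul, h1, smul_eq_mul, mul_one] at this

lemma isi_lower {m : Type*} [Fintype m] [DecidableEq m] (A : Matrix m m ℝ) (hA : A.IsHermitian)
    (ht : A.trace = 0) (x y : m → ℝ) (X Y : ℝ) (hX : 0 < X) (hY : 0 < Y)
    (hx : x ⬝ᵥ x = X) (hy : y ⬝ᵥ y = Y) (hxy : x ⬝ᵥ y = 0) :
    2 * ((x ⬝ᵥ (A *ᵥ x)) / X + (y ⬝ᵥ (A *ᵥ y)) / Y) ≤ matrixEnergy A := by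
  obtain ⟨l, v, hE, hv, h1, hN⟩ := isi_spec A hA
  have key : ∀ z : m → ℝ, z ⬝ᵥ (A *ᵥ z) = ∑ i, l i * (z ⬝ᵥ v i) ^ 2 := by
    intro z
    rw [dotProduct_mulVec, dotProduct_comm, ← trace_vecMulVec, ← vecMulVec_mul,
      ← hN (vecMulVec z z * A)]
    apply Finset.sum_congr rfl
    intro i _
    rw [← mulVec_mulVec, hv, mulVec_smul, dotProduct_smul, vecMulVec_mulVec]
    simp only [dotProduct_comm, smul_eq_mul, dotProduct_smul, op_smul_eq_smul]
    ring
  have htr : ∑ i, l i = 0 := by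
    rw [← ht, ← hN A]
    apply Finset.sum_congr rfl
    intro i _
    rw [hv, dotProduct_smul, h1, smul_eq_mul, mul_one]
  rw [key, key, hE]
  have e : 2 * ((∑ i, l i * (x ⬝ᵥ v i) ^ 2) / X + (∑ i, l i * (y ⬝ᵥ v i) ^ 2) / Y)
      = ∑ i, l i * (2 * ((x ⬝ᵥ v i) ^ 2 / X + (y ⬝ᵥ v i) ^ 2 / Y) - 1) := by
    simp only [mul_sub, mul_one, Finset.sum_sub_distrib, htr, sub_zero, Finset.sum_div,
      Finset.mul_sum, ← Finset.sum_add_distrib]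
    apply Finset.sum_congr rfl
    intro i _
    ring
  rw [e]
  apply Finset.sum_le_sum
  intro i _
  set a := x ⬝ᵥ v i with ha
  set b := y ⬝ᵥ v i with hb
  have h0 : 0 ≤ a ^ 2 / X + b ^ 2 / Y := by positivity
  have h2 : a ^ 2 / X + b ^ 2 / Y ≤ 1 := by
    have hs : 0 ≤ (v i - (a / X) • x - (b / Y) • y) ⬝ᵥ (v i - (a / X) • x - (b / Y) • y) :=
      Finset.sum_nonneg fun j _ => mul_self_nonneg _
    simp only [sub_dotProduct, dotProduct_sub, smul_dotProduct, dotProduct_smul, h1, hx, hy, hxy,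
      dotProduct_comm (v i) x, dotProduct_comm (v i) y, dotProduct_comm y x, ← ha, ← hb,
      smul_eq_mul] at hs
    have e1 : a / X * (a / X * X) = a ^ 2 / X := by field_simp
    have e2 : b / Y * (b / Y * Y) = b ^ 2 / Y := by field_simp
    have e3 : a / X * a = a ^ 2 / X := by ring
    have e4 : b / Y * b = b ^ 2 / Y := by ring
    simp only [e1, e2, e3, e4] at hs
    linarith
  calc _ ≤ |l i * (2 * (a ^ 2 / X + b ^ 2 / Y) - 1)| := le_abs_self _
    _ = |l i| * |2 * (a ^ 2 / X + b ^ 2 / Y) - 1| := abs_mul _ _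
    _ ≤ |l i| * 1 := by
        gcongr
        rw [abs_le]
        constructor <;> linarith
    _ = _ := mul_one _

lemma isi_K (p : ℕ)
    (AK : Matrix (Fin 3 × Fin p) (Fin 3 × Fin p) ℝ)
    (hAK : ∀ u v, AK u v = if u.1 ≠ v.1 then (p : ℝ) else 0) :
    matrixEnergy AK ≤ 4 * (p : ℝ) ^ 2 := by
  let M : Matrix (Fin 3 × Fin p) (Fin 3 × Fin p) ℝ :=
    fun u v => if u.1 ≠ v.1 then (p : ℝ) / 3 else 4 * p / 3
  have hM : M.trace = 4 * (p : ℝ) ^ 2 := by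
    simp [Matrix.trace, Matrix.diag, M]
    ring
  rw [← hM]
  apply isi_upper
  · ext u v
    simp [hAK, eq_comm]
  · intro v
    have eA : v ⬝ᵥ (AK *ᵥ v) = 2 * p * ((∑ j, v (0, j)) * (∑ j, v (1, j)) +
        (∑ j, v (0, j)) * (∑ j, v (2, j)) + (∑ j, v (1, j)) * (∑ j, v (2, j))) := by
      simp only [dotProduct, mulVec, hAK, Fintype.sum_prod_type, Fin.sum_univ_three]
      simp [← Finset.mul_sum, ← Finset.sum_mul]
      ring
    have eM : v ⬝ᵥ (M *ᵥ v) = p / 3 * (2 * ((∑ j, v (0, j)) * (∑ j, v (1, j)) +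
        (∑ j, v (0, j)) * (∑ j, v (2, j)) + (∑ j, v (1, j)) * (∑ j, v (2, j)))
        + 4 * ((∑ j, v (0, j)) ^ 2 + (∑ j, v (1, j)) ^ 2 + (∑ j, v (2, j)) ^ 2)) := by
      simp only [dotProduct, mulVec, M, Fintype.sum_prod_type, Fin.sum_univ_three]
      simp [← Finset.mul_sum, ← Finset.sum_mul]
      ring
    rw [eA, eM]
    generalize (∑ j, v (0, j)) = a
    generalize (∑ j, v (1, j)) = b
    generalize (∑ j, v (2, j)) = c
    have hp : (0 : ℝ) ≤ p := by positivity
    rw [abs_le]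
    constructor
    · have := mul_nonneg hp (sq_nonneg (a + b + c))
      nlinarith
    · have := mul_nonneg hp (add_nonneg (add_nonneg (sq_nonneg (a - b)) (sq_nonneg (a - c)))
        (sq_nonneg (b - c)))
      nlinarith

lemma isi_e (q : ℕ) (r : ℝ)
    (A : Matrix (Fin 3 × Fin (q + 1)) (Fin 3 × Fin (q + 1)) ℝ)
    (hA : A.IsHermitian)
    (h00 : ∀ i j k, A (i, j) (i, k) = 0)
    (h01 : ∀ j k, A (0, j) (1, k) = if j = 0 then (if k = 0 then 0 else r) else
      (if k = 0 then r else (q + 1 : ℝ)))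
    (h02 : ∀ j k, A (0, j) (2, k) = if j = 0 then r else (q + 1 : ℝ))
    (h12 : ∀ j k, A (1, j) (2, k) = if j = 0 then r else (q + 1 : ℝ)) (hq : 0 < q) :
    2 * ((2 * (2 * (2 * q + 1) * r + (3 * q ^ 2 + 2 * q) * (q + 1))) / (3 * (q + 1)) +
      (2 * q * (2 * q * r - q * (q + 1))) / (2 * q * (q + 1))) ≤ matrixEnergy A := by
  have hs : ∀ u v, A u v = A v u := fun u v => by simpa using (hA.apply v u)
  have h10 : ∀ j k, A (1, j) (0, k) = if k = 0 then (if j = 0 then 0 else r) else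
      (if j = 0 then r else (q + 1 : ℝ)) := fun j k => by rw [hs, h01]
  have h20 : ∀ k j, A (2, k) (0, j) = if j = 0 then r else (q + 1 : ℝ) :=
    fun j k => by rw [hs, h02]
  have h21 : ∀ k j, A (2, k) (1, j) = if j = 0 then r else (q + 1 : ℝ) :=
    fun j k => by rw [hs, h12]
  have hq' : (0 : ℝ) < q := by exact_mod_cast hq
  let y : Fin 3 × Fin (q + 1) → ℝ := fun u =>
    (if u.1 = 0 then 1 else if u.1 = 1 then -1 else 0) * (if u.2 = 0 then (q : ℝ) else -1)
  have := isi_lower A hA (by simp [Matrix.trace, h00, Fintype.sum_prod_type]) (fun _ => 1) y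
    (3 * (q + 1)) (2 * q * (q + 1)) (by positivity) (by positivity)
    (by simp [dotProduct]) 
    (by simp [dotProduct, y, Fintype.sum_prod_type, Fin.sum_univ_three, Fin.sum_univ_succ]; ring)
    (by simp [dotProduct, y, Fintype.sum_prod_type, Fin.sum_univ_three, Fin.sum_univ_succ])
  convert this using 5
  · simp only [dotProduct, mulVec, Fintype.sum_prod_type, Fin.sum_univ_three, h00, h01, h02, h12,
      h10, h20, h21]
    simp [Fin.sum_univ_succ]
    ring
  · simp only [dotProduct, mulVec, Fintype.sum_prod_type, Fin.sum_univ_three, h00, h01, h02, h12,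
      h10, h20, h21, y]
    simp [Fin.sum_univ_succ]
    ring

/-- For every `p ≥ 3`, the ISI energy of the regular complete tripartite graph
`K_{p,p,p}` strictly increases upon deletion of an edge:
`Ė_ISI(K_{p,p,p} - e) > Ė_ISI(K_{p,p,p})`. -/
theorem ISI_energy_tripartite_increases_on_edge_deletion
    (p : ℕ) (hp : 3 ≤ p)
    (AK : Matrix (Fin 3 × Fin p) (Fin 3 × Fin p) ℝ)
    (hAK : ∀ u v, AK u v =
      if u.1 ≠ v.1
      then (2 * (p : ℝ)) * (2 * (p : ℝ)) / ((2 * (p : ℝ)) + (2 * (p : ℝ))) else 0)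
    (d : Fin 3 × Fin p → ℕ)
    (hd : ∀ u, d u =
      if ((u.1 : ℕ) = 0 ∧ (u.2 : ℕ) = 0) ∨ ((u.1 : ℕ) = 1 ∧ (u.2 : ℕ) = 0)
      then 2 * p - 1 else 2 * p)
    (Ae : Matrix (Fin 3 × Fin p) (Fin 3 × Fin p) ℝ)
    (hAe : ∀ u v, Ae u v =
      if u.1 ≠ v.1 ∧
        ¬((u.1 : ℕ) = 0 ∧ (u.2 : ℕ) = 0 ∧ (v.1 : ℕ) = 1 ∧ (v.2 : ℕ) = 0) ∧
        ¬((u.1 : ℕ) = 1 ∧ (u.2 : ℕ) = 0 ∧ (v.1 : ℕ) = 0 ∧ (v.2 : ℕ) = 0)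
      then ((d u : ℝ) * (d v : ℝ)) / ((d u : ℝ) + (d v : ℝ)) else 0) :
    matrixEnergy Ae > matrixEnergy AK := by
  have hp0 : (0 : ℝ) < p := by exact_mod_cast (by omega : 0 < p)
  have hK : matrixEnergy AK ≤ 4 * (p : ℝ) ^ 2 := by
    apply isi_K
    intro u v
    rw [hAK]
    congr 1
    field_simp
    norm_num
  refine lt_of_le_of_lt hK ?_
  clear hK hAK
  obtain ⟨q, rfl⟩ : ∃ q, p = q + 1 := ⟨p - 1, by omega⟩
  have hq : (2 : ℝ) ≤ q := by exact_mod_cast (by omega : 2 ≤ q)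
  have d0 : ∀ u, (d u : ℝ) = if (u.1 = 0 ∨ u.1 = 1) ∧ u.2 = 0 then 2 * (q : ℝ) + 1
      else 2 * (q + 1) := by
    rintro ⟨i, j⟩
    rw [hd]
    have e : 2 * (q + 1) - 1 = 2 * q + 1 := by omega
    rw [e]
    have ej : ((j : ℕ) = 0) ↔ j = 0 := by rw [Fin.ext_iff]; rfl
    fin_cases i <;> simp [ej] <;> split_ifs <;> push_cast <;> ring
  have key := isi_e q ((2 * q + 1) * (2 * (q + 1)) / (4 * q + 3)) Ae ?_ ?_ ?_ ?_ ?_ (by omega)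
  · refine lt_of_lt_of_le ?_ key
    push_cast
    have e : 2 * ((2 * (2 * (2 * (q : ℝ) + 1) * ((2 * q + 1) * (2 * (q + 1)) / (4 * q + 3)) + (3 * q ^ 2 + 2 * q) * (q + 1))) / (3 * (q + 1)) +
      (2 * q * (2 * q * ((2 * q + 1) * (2 * (q + 1)) / (4 * q + 3)) - q * (q + 1))) / (2 * q * (q + 1))) - 4 * ((q : ℝ) + 1) ^ 2 =
        (24 * q ^ 2 - 26 * q - 20) / (3 * (4 * q + 3)) := by
      field_simp
      ring
    have : 0 < (24 * (q : ℝ) ^ 2 - 26 * q - 20) / (3 * (4 * q + 3)) := by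
      apply div_pos <;> nlinarith
    linarith
  · ext u v
    simp only [conjTranspose_apply, star_trivial, hAe, mul_comm, add_comm]
    congr 1
    apply propext
    tauto
  · intro i j k
    simp [hAe]
  · intro j k
    simp only [hAe, d0]
    have ej : ∀ j : Fin (q + 1), ((j : ℕ) = 0) ↔ j = 0 := fun j => by rw [Fin.ext_iff]; rfl
    simp [ej]
    clear hAe hd d0 hp0
    by_cases h1 : j = 0 <;> by_cases h2 : k = 0 <;> simp only [h1, h2] <;> simp <;> field_simp <;>
      ring
  · intro j k
    simp only [hAe, d0]
    simp
    split_ifs <;> field_simp <;> ring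
  · intro j k
    simp only [hAe, d0]
    simp
    split_ifs <;> field_simp <;> ring
end

section
/- For every t ≥ 3 and p ≥ 3, the ISI energy of the regular complete t-partite graph K_{p,…,p} (t parts each of size p) increases upon deletion of an edge: Ė_ISI(K_{p,…,p} − e) > Ė_ISI(K_{p,…,p}). -/
open Polynomial Matrix

lemma en_eq {m : Type*} [Fintype m] [DecidableEq m] (A : Matrix m m ℝ) (hA : A.IsHermitian)
    (h0 : A.trace = 0) : matrixEnergy A = 2 * ∑ i, max (hA.eigenvalues i) 0 := by
  have h1 : matrixEnergy A = ∑ i, |hA.eigenvalues i| := by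
    unfold matrixEnergy
    rw [hA.roots_charpoly_eq_eigenvalues]
    simp
  have h2 : ∑ i, hA.eigenvalues i = 0 := by
    have := hA.trace_eq_sum_eigenvalues
    rw [h0] at this
    simpa using this.symm
  have h3 : ∑ i, |hA.eigenvalues i| = ∑ i, (2 * max (hA.eigenvalues i) 0 - hA.eigenvalues i) := by
    apply Finset.sum_congr rfl
    intro i _
    rcases le_total (hA.eigenvalues i) 0 with h | h
    · rw [abs_of_nonpos h, max_eq_right h]; ring
    · rw [abs_of_nonneg h, max_eq_left h]; ring
  rw [h1, h3, Finset.sum_sub_distrib, h2, Finset.mul_sum]; ring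

/-- Spectral data in elementary form. -/
lemma spec {m : Type*} [Fintype m] [DecidableEq m] (A : Matrix m m ℝ) (hA : A.IsHermitian) :
    ∃ e : m → m → ℝ, (∀ i, e i ⬝ᵥ e i = 1) ∧
      (∀ i, A *ᵥ e i = hA.eigenvalues i • e i) ∧
      (∀ u : m → ℝ, ∑ i, (u ⬝ᵥ e i) ^ 2 = u ⬝ᵥ u) ∧
      (∀ u : m → ℝ, ∑ i, hA.eigenvalues i * (u ⬝ᵥ e i) ^ 2 = u ⬝ᵥ (A *ᵥ u)) := by
  have key : ∀ u v : m → ℝ, ∑ i, (u ⬝ᵥ (hA.eigenvectorBasis i : m → ℝ)) *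
      (v ⬝ᵥ (hA.eigenvectorBasis i : m → ℝ)) = u ⬝ᵥ v := by
    intro u v
    have := hA.eigenvectorBasis.sum_inner_mul_inner (WithLp.toLp 2 u) (WithLp.toLp 2 v)
    simp only [EuclideanSpace.inner_eq_star_dotProduct, star_trivial] at this
    rw [dotProduct_comm u v, ← this]
    apply Finset.sum_congr rfl
    intro i _
    rw [dotProduct_comm u]
  have hev : ∀ i, A *ᵥ (hA.eigenvectorBasis i : m → ℝ) =
      hA.eigenvalues i • (hA.eigenvectorBasis i : m → ℝ) := fun i => hA.mulVec_eigenvectorBasis i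
  refine ⟨fun i => hA.eigenvectorBasis i, ?_, hev, ?_, ?_⟩
  · intro i
    have := hA.eigenvectorBasis.orthonormal.1 i
    have h2 := real_inner_self_eq_norm_sq (hA.eigenvectorBasis i)
    rw [this] at h2
    rw [EuclideanSpace.inner_eq_star_dotProduct, star_trivial] at h2
    rw [h2]; norm_num
  · intro u
    rw [← key u u]
    exact Finset.sum_congr rfl fun i _ => sq _
  · intro u
    rw [← key u (A *ᵥ u)]
    apply Finset.sum_congr rfl
    intro i _
    have : (A *ᵥ u) ⬝ᵥ (hA.eigenvectorBasis i : m → ℝ) =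
        hA.eigenvalues i * (u ⬝ᵥ (hA.eigenvectorBasis i : m → ℝ)) := by
      have hT : Aᵀ = A := by simpa [Matrix.IsHermitian, conjTranspose_eq_transpose_of_trivial] using hA
      have h1 : A *ᵥ u = u ᵥ* A := by
        conv_lhs => rw [← hT]
        exact mulVec_transpose A u
      rw [h1, ← dotProduct_mulVec, hev i, dotProduct_smul, smul_eq_mul]
    rw [this]; ring

lemma en_upper {m : Type*} [Fintype m] [DecidableEq m] (A : Matrix m m ℝ) (hA : A.IsHermitian)
    (h0 : A.trace = 0) (c : ℝ) (hc : 0 ≤ c) (w : m → ℝ)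
    (h : ∀ x, x ⬝ᵥ (A *ᵥ x) ≤ c * (w ⬝ᵥ x) ^ 2) :
    matrixEnergy A ≤ 2 * (c * (w ⬝ᵥ w)) := by
  obtain ⟨e, h1, h2, h3, h4⟩ := spec A hA
  rw [en_eq A hA h0, ← h3 w, Finset.mul_sum _ _ c]
  have : ∀ i ∈ Finset.univ, max (hA.eigenvalues i) 0 ≤ c * (w ⬝ᵥ e i) ^ 2 := by
    intro i _
    have := h (e i)
    rw [h2 i, dotProduct_smul, h1 i] at this
    simp only [smul_eq_mul, mul_one] at this
    exact max_le this (by positivity)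
  have := Finset.sum_le_sum this
  linarith

lemma en_lower {m : Type*} [Fintype m] [DecidableEq m] (A : Matrix m m ℝ) (hA : A.IsHermitian)
    (h0 : A.trace = 0) (u v : m → ℝ) (U V : ℝ) (hU : u ⬝ᵥ u = U) (hV : v ⬝ᵥ v = V)
    (hU0 : 0 < U) (hV0 : 0 < V) (huv : u ⬝ᵥ v = 0) :
    2 * (u ⬝ᵥ (A *ᵥ u) / U + v ⬝ᵥ (A *ᵥ v) / V) ≤ matrixEnergy A := by
  obtain ⟨e, h1, h2, h3, h4⟩ := spec A hA
  rw [en_eq A hA h0, ← h4 u, ← h4 v, Finset.sum_div, Finset.sum_div, ← Finset.sum_add_distrib]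
  have : ∀ i ∈ Finset.univ, hA.eigenvalues i * (u ⬝ᵥ e i) ^ 2 / U
      + hA.eigenvalues i * (v ⬝ᵥ e i) ^ 2 / V ≤ max (hA.eigenvalues i) 0 := by
    intro i _
    have hb : (u ⬝ᵥ e i) ^ 2 / U + (v ⬝ᵥ e i) ^ 2 / V ≤ 1 := by
      set a := u ⬝ᵥ e i with ha
      set b := v ⬝ᵥ e i with hb
      have hx : 0 ≤ (e i - (a / U) • u - (b / V) • v) ⬝ᵥ (e i - (a / U) • u - (b / V) • v) :=
        Finset.sum_nonneg fun j _ => mul_self_nonneg _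
      simp only [sub_dotProduct, dotProduct_sub, smul_dotProduct, dotProduct_smul, h1, hU, hV,
        huv, dotProduct_comm v u, dotProduct_comm (e i) u, dotProduct_comm (e i) v, ← ha, ← hb,
        smul_eq_mul] at hx
      have e1 : a / U * (a / U * U) = a ^ 2 / U := by field_simp
      have e2 : b / V * (b / V * V) = b ^ 2 / V := by field_simp
      have e3 : a / U * a = a ^ 2 / U := by ring
      have e4 : b / V * b = b ^ 2 / V := by ring
      nlinarith
    have hn : 0 ≤ (u ⬝ᵥ e i) ^ 2 / U + (v ⬝ᵥ e i) ^ 2 / V := by positivity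
    have : hA.eigenvalues i * (u ⬝ᵥ e i) ^ 2 / U + hA.eigenvalues i * (v ⬝ᵥ e i) ^ 2 / V
      = hA.eigenvalues i * ((u ⬝ᵥ e i) ^ 2 / U + (v ⬝ᵥ e i) ^ 2 / V) := by ring
    rw [this]
    rcases le_total (hA.eigenvalues i) 0 with h | h
    · rw [max_eq_right h]; nlinarith
    · rw [max_eq_left h]; nlinarith
  have := Finset.sum_le_sum this
  linarith

/-- Bilinear form of the off-block all ones matrix. -/
lemma bil {t p : ℕ} (g k : Fin t × Fin p → ℝ) :
    ∑ u, ∑ v, (if u.1 ≠ v.1 then g u * k v else 0) =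
      (∑ i, ∑ j, g (i, j)) * (∑ i, ∑ j, k (i, j))
        - ∑ i, (∑ j, g (i, j)) * (∑ j, k (i, j)) := by
  have h1 : ∀ u v : Fin t × Fin p, (if u.1 ≠ v.1 then g u * k v else 0) =
      g u * k v - (if u.1 = v.1 then g u * k v else 0) := by
    intro u v; by_cases h : u.1 = v.1 <;> simp [h]
  simp only [h1, Finset.sum_sub_distrib]
  congr 1
  · simp only [← Finset.mul_sum, ← Finset.sum_mul, Fintype.sum_prod_type]
  · simp only [Fintype.sum_prod_type]
    apply Finset.sum_congr rfl
    intro i _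
    rw [Finset.sum_mul]
    apply Finset.sum_congr rfl
    intro j _
    rw [Finset.sum_eq_single i]
    · simp [Finset.mul_sum]
    · intro b _ hb
      simp [hb.symm]
    · simp

lemma quad {m : Type*} [Fintype m] (A : Matrix m m ℝ) (x : m → ℝ) :
    x ⬝ᵥ (A *ᵥ x) = ∑ u, ∑ v, x u * A u v * x v := by
  simp only [dotProduct, mulVec, Finset.mul_sum, mul_assoc]

/-- For every `t ≥ 3` and `p ≥ 3`, the ISI energy of the regular complete
`t`-partite graph `K_{p,…,p}` strictly increases upon deletion of an edge:
`Ė_ISI(K_{p,…,p} - e) > Ė_ISI(K_{p,…,p})`. -/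
theorem ISI_energy_multipartite_increases_on_edge_deletion
    (t p : ℕ) (ht : 3 ≤ t) (hp : 3 ≤ p)
    (AK : Matrix (Fin t × Fin p) (Fin t × Fin p) ℝ)
    (hAK : ∀ u v, AK u v =
      if u.1 ≠ v.1
      then (((t : ℝ) - 1) * (p : ℝ)) * (((t : ℝ) - 1) * (p : ℝ)) /
            ((((t : ℝ) - 1) * (p : ℝ)) + (((t : ℝ) - 1) * (p : ℝ))) else 0)
    (d : Fin t × Fin p → ℕ)
    (hd : ∀ u, d u =
      if ((u.1 : ℕ) = 0 ∧ (u.2 : ℕ) = 0) ∨ ((u.1 : ℕ) = 1 ∧ (u.2 : ℕ) = 0)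
      then (t - 1) * p - 1 else (t - 1) * p)
    (Ae : Matrix (Fin t × Fin p) (Fin t × Fin p) ℝ)
    (hAe : ∀ u v, Ae u v =
      if u.1 ≠ v.1 ∧
        ¬((u.1 : ℕ) = 0 ∧ (u.2 : ℕ) = 0 ∧ (v.1 : ℕ) = 1 ∧ (v.2 : ℕ) = 0) ∧
        ¬((u.1 : ℕ) = 1 ∧ (u.2 : ℕ) = 0 ∧ (v.1 : ℕ) = 0 ∧ (v.2 : ℕ) = 0)
      then ((d u : ℝ) * (d v : ℝ)) / ((d u : ℝ) + (d v : ℝ)) else 0) :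
    matrixEnergy Ae > matrixEnergy AK := by
  have hK : matrixEnergy AK ≤ 2 * ((((t : ℝ) - 1) * p / 2) * (((t : ℝ) - 1) * p)) := by
    have ht' : (3 : ℝ) ≤ t := by exact_mod_cast ht
    have hp' : (3 : ℝ) ≤ p := by exact_mod_cast hp
    have hD0 : 0 < ((t : ℝ) - 1) * p := by nlinarith
    set D : ℝ := ((t : ℝ) - 1) * p with hD
    have hAK' : ∀ u v, AK u v = if u.1 ≠ v.1 then D / 2 else 0 := by
      intro u v
      rw [hAK]
      congr 1
      field_simp
      norm_num
    have hH : AK.IsHermitian := by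
      ext u v
      simp only [conjTranspose_apply, star_trivial, hAK', ne_comm]
    have h0 : AK.trace = 0 := by simp [Matrix.trace, hAK']
    have := en_upper AK hH h0 (D / 2 * (1 - 1 / t)) ?_ (fun _ => 1) ?_
    · refine this.trans (le_of_eq ?_)
      simp [dotProduct]
      rw [hD]
      field_simp
    · have : (1 : ℝ) / t ≤ 1 := by
        rw [div_le_one (by linarith)]; linarith
      have : 0 ≤ 1 - (1 : ℝ) / t := by linarith
      positivity
    · intro x
      have hq : x ⬝ᵥ (AK *ᵥ x) =
          D / 2 * ((∑ i, ∑ j, x (i, j)) * (∑ i, ∑ j, x (i, j))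
        - ∑ i, (∑ j, x (i, j)) * (∑ j, x (i, j))) := by
        rw [← bil, quad, Finset.mul_sum]
        refine Finset.sum_congr rfl fun u _ => ?_
        rw [Finset.mul_sum]
        refine Finset.sum_congr rfl fun v _ => ?_
        rw [hAK']
        split_ifs <;> ring
      rw [hq]
      have hs : (fun _ => (1 : ℝ)) ⬝ᵥ x = ∑ i, ∑ j, x (i, j) := by
        simp [dotProduct, Fintype.sum_prod_type]
      rw [hs]
      have hcs := sq_sum_le_card_mul_sum_sq (s := (Finset.univ : Finset (Fin t)))
        (f := fun i => ∑ j, x (i, j))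
      simp only [Finset.card_univ, Fintype.card_fin] at hcs
      rw [mul_assoc]
      apply mul_le_mul_of_nonneg_left _ (by positivity)
      have : (∑ i, ∑ j, x (i, j)) ^ 2 / t ≤ ∑ i, (∑ j, x (i, j)) ^ 2 := by
        rw [div_le_iff₀ (by linarith)]; linarith
      simp only [← sq]
      have e : (1 - 1 / (t : ℝ)) * (∑ i, ∑ j, x (i, j)) ^ 2 = (∑ i, ∑ j, x (i, j)) ^ 2
        - (∑ i, ∑ j, x (i, j)) ^ 2 / t := by ring
      rw [e]; linarith
  refine lt_of_le_of_lt hK ?_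
  clear hK hAK AK
  obtain ⟨k, rfl⟩ : ∃ k, t = k + 3 := ⟨t - 3, by omega⟩
  obtain ⟨l, rfl⟩ : ∃ l, p = l + 3 := ⟨p - 3, by omega⟩
  set D : ℝ := (((k + 3 : ℕ) : ℝ) - 1) * ((l + 3 : ℕ) : ℝ) with hD
  have hDe : D = ((k : ℝ) + 2) * (l + 3) := by rw [hD]; push_cast; ring
  have hk : (0 : ℝ) ≤ k := by positivity
  have hl : (0 : ℝ) ≤ l := by positivity
  have hD6 : 6 ≤ D := by rw [hDe]; nlinarith [mul_nonneg hk hl]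
  let s : Fin (k + 3) → ℝ := fun i => if (i : ℕ) = 0 then 1 else if (i : ℕ) = 1 then 1 else 0
  let g : Fin (k + 3) → ℝ := fun i => if (i : ℕ) = 0 then 1 else if (i : ℕ) = 1 then -1 else 0
  let z : Fin (l + 3) → ℝ := fun j => if (j : ℕ) = 0 then 1 else 0
  have hs1 : ∑ i, s i = 2 := by simp [s, Fin.sum_univ_succ]; norm_num
  have hs2 : ∑ i, s i * s i = 2 := by simp [s, Fin.sum_univ_succ]; norm_num
  have hg1 : ∑ i, g i = 0 := by simp [g, Fin.sum_univ_succ]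
  have hg2 : ∑ i, g i * g i = 2 := by simp [g, Fin.sum_univ_succ]; norm_num
  have hz1 : ∑ j, z j = 1 := by simp [z, Fin.sum_univ_succ]
  have hzz : ∀ j, z j * z j = z j := by intro j; simp only [z]; split_ifs <;> norm_num
  have hsg : ∀ j, s j * g j = g j := by intro j; simp only [s, g]; split_ifs <;> norm_num
  let δ : Fin (k + 3) × Fin (l + 3) → ℝ := fun u => s u.1 * z u.2
  let x : Fin (k + 3) × Fin (l + 3) → ℝ := fun u => g u.1 * (((l : ℝ) + 3) * z u.2 - 1)
  let w : ℝ := D * (D - 1) / (2 * D - 1)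
  have hdR : ∀ u, (d u : ℝ) = if ((u.1 : ℕ) = 0 ∧ (u.2 : ℕ) = 0) ∨ ((u.1 : ℕ) = 1 ∧ (u.2 : ℕ) = 0)
      then D - 1 else D := by
    intro u
    rw [hd]
    have e : (k + 3 - 1) * (l + 3) = (k + 2) * (l + 3) := rfl
    have e1 : 1 ≤ (k + 2) * (l + 3) := Nat.mul_pos (by omega) (by omega)
    rw [e]
    split_ifs
    · rw [Nat.cast_sub e1, hDe]; push_cast; ring
    · rw [hDe]; push_cast; ring
  have hAe' : ∀ u v, Ae u v = if u.1 ≠ v.1 then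
      D / 2 - (D / 2 - w) * (δ u + δ v) + (D / 2 - 2 * w) * (δ u * δ v) else 0 := by
    rintro ⟨i, j⟩ ⟨i', j'⟩
    rw [hAe, hdR, hdR]
    have hne : i ≠ i' ↔ (i : ℕ) ≠ i' := by rw [Ne, Fin.ext_iff]
    have w1 : D * D / (D + D) = D / 2 := by
      have : D ≠ 0 := by linarith
      field_simp; norm_num
    have w2 : D * (D - 1) / (D + (D - 1)) = w := by
      simp only [w]; congr 1; ring
    have w3 : (D - 1) * D / (D - 1 + D) = w := by
      simp only [w]; congr 1 <;> ring
    simp only [δ, s, z, hne]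
    by_cases hj : (j : ℕ) = 0 <;> by_cases hj' : (j' : ℕ) = 0 <;>
    by_cases hi : (i : ℕ) = 0 <;> by_cases hi' : (i' : ℕ) = 0 <;>
    by_cases hi1 : (i : ℕ) = 1 <;> by_cases hi1' : (i' : ℕ) = 1 <;>
    first
    | (exfalso; omega)
    | (simp [hj, hj', hi, hi', hi1, hi1', w1, w2, w3, Ne.symm] <;> try ring_nf)
  have hH : Ae.IsHermitian := by
    ext u v
    simp only [conjTranspose_apply, star_trivial, hAe']
    by_cases h : u.1 = v.1
    · simp [h]
    · have h' : v.1 ≠ u.1 := fun e => h e.symm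
      simp only [ne_eq, h, h', not_false_eq_true, if_true]; ring
  have h0 : Ae.trace = 0 := by simp [Matrix.trace, hAe']
  have hquad : ∀ y : Fin (k + 3) × Fin (l + 3) → ℝ, y ⬝ᵥ (Ae *ᵥ y) =
      D / 2 * (∑ u, ∑ v, (if u.1 ≠ v.1 then y u * y v else 0))
      - (D / 2 - w) * (∑ u, ∑ v, (if u.1 ≠ v.1 then (δ u * y u) * y v else 0))
      - (D / 2 - w) * (∑ u, ∑ v, (if u.1 ≠ v.1 then y u * (δ v * y v) else 0))
      + (D / 2 - 2 * w) * (∑ u, ∑ v, (if u.1 ≠ v.1 then (δ u * y u) * (δ v * y v) else 0)) := by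
    intro y
    rw [quad]
    simp only [Finset.mul_sum, ← Finset.sum_sub_distrib, ← Finset.sum_add_distrib]
    refine Finset.sum_congr rfl fun u _ => Finset.sum_congr rfl fun v _ => ?_
    rw [hAe']
    split_ifs <;> ring
  have hx0 : ∀ i, ∑ j, x (i, j) = 0 := by
    intro i
    simp only [x, ← Finset.mul_sum, Finset.sum_sub_distrib, hz1]
    simp
  have hδ : ∀ i, ∑ j, δ (i, j) = s i := by
    intro i
    simp only [δ, ← Finset.mul_sum, hz1, mul_one]
  have hδx : ∀ i, ∑ j, δ (i, j) * x (i, j) = g i * (l + 2) := by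
    intro i
    have : ∀ j, δ (i, j) * x (i, j) = (g i * (l + 2)) * z j := by
      intro j
      simp only [δ, x]
      linear_combination (z j * ((l + 3) * z j - 1)) * hsg i + g i * (l + 3) * hzz j
    simp only [this, ← Finset.mul_sum, hz1, mul_one]
  have q1 : (fun _ => (1 : ℝ)) ⬝ᵥ (Ae *ᵥ (fun _ => (1 : ℝ))) =
      D / 2 * (((k : ℝ) + 3) * (l + 3) * D) - (D / 2 - w) * (4 * D) + (D / 2 - 2 * w) * 2 := by
    rw [hquad, bil, bil, bil, bil]
    simp only [mul_one, hδ, hs1, hs2, ← Finset.sum_mul, ← Finset.mul_sum]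
    simp [hs1]
    rw [hDe]; ring
  have q2 : x ⬝ᵥ (Ae *ᵥ x) = (2 * w - D / 2) * (2 * ((l : ℝ) + 2) ^ 2) := by
    rw [hquad, bil, bil, bil, bil]
    have e : ∀ i, g i * ((l : ℝ) + 2) * (g i * (l + 2)) = (g i * g i) * (l + 2) ^ 2 := by
      intro i; ring
    simp only [hx0, hδx, e, ← Finset.sum_mul, hg1, hg2]
    simp
    ring
  have n1 : (fun _ => (1 : ℝ)) ⬝ᵥ (fun _ : Fin (k + 3) × Fin (l + 3) => (1 : ℝ)) =
      ((k : ℝ) + 3) * (l + 3) := by simp [dotProduct]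
  have n2 : x ⬝ᵥ x = 2 * (((l : ℝ) + 2) * (l + 3)) := by
    have e : ∀ i j, x (i, j) * x (i, j) = (g i * g i) * ((l + 3) * (l + 1) * z j + 1) := by
      intro i j
      simp only [x]
      linear_combination (g i * g i) * (l + 3) ^ 2 * hzz j
    simp only [dotProduct, Fintype.sum_prod_type, e, ← Finset.mul_sum, Finset.sum_add_distrib, hz1,
      ← Finset.sum_mul, hg2]
    simp
    ring
  have n3 : (fun _ => (1 : ℝ)) ⬝ᵥ x = 0 := by
    simp only [dotProduct, Fintype.sum_prod_type, one_mul, hx0]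
    simp
  have main := en_lower Ae hH h0 (fun _ => 1) x _ _ n1 n2 (by positivity) (by positivity) n3
  refine lt_of_lt_of_le ?_ main
  rw [q1, q2]
  have hD1 : 0 < 2 * D - 1 := by linarith
  have hne : 2 * D - 1 ≠ 0 := hD1.ne'
  have hne' : D * 2 - 1 ≠ 0 := by rw [mul_comm]; exact hne
  have hw : w = D / 2 - D / (2 * (2 * D - 1)) := by
    simp only [w]; field_simp; ring
  set r := D / (2 * (2 * D - 1)) with hr
  have hr0 : 0 < r := by positivity
  have hDr : D / 2 = r * (2 * D - 1) := by rw [hr]; field_simp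
  rw [hw]
  have hlast : 8 * D - 6 < (2 * D - 3) * ((k + 3) * (l + 2)) := by
    nlinarith [mul_nonneg hk hl]
  have hgoal : (D / 2 * (((k : ℝ) + 3) * (l + 3) * D) - (D / 2 - (D / 2 - r)) * (4 * D)
      + (D / 2 - 2 * (D / 2 - r)) * 2) / (((k : ℝ) + 3) * (l + 3))
      + (2 * (D / 2 - r) - D / 2) * (2 * ((l : ℝ) + 2) ^ 2) / (2 * (((l : ℝ) + 2) * (l + 3)))
      = D / 2 * D + r * ((2 * D - 3) * ((k + 3) * (l + 2)) - (8 * D - 6))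
          / (((k : ℝ) + 3) * (l + 3)) := by
    rw [hDr]
    field_simp
    ring
  rw [hgoal]
  have : 0 < r * ((2 * D - 3) * ((k + 3) * (l + 2)) - (8 * D - 6))
          / (((k : ℝ) + 3) * (l + 3)) := by
    have := sub_pos.2 hlast
    positivity
  linarith
end

section
/- Let p ≥ 2, t ≥ 2, and let C_{p,…,p} be the crown multipartite graph on n = pt vertices, which is regular of degree d = (t−1)(p−1). Then the characteristic polynomial of Ȧ(C_{p,…,p}) equals (x − φ(d,d))^{(t−1)(p−1)}·(x + (p−1)φ(d,d))^{t−1}·(x + (t−1)φ(d,d))^{p−1}·(x − (p−1)(t−1)φ(d,d)); i.e., the spectrum consists of φ(d,d) with multiplicity (t−1)(p−1), −(p−1)φ(d,d) with multiplicity t−1, −(t−1)φ(d,d) with multiplicity p−1, and the simple eigenvalue (p−1)(t−1)φ(d,d). Moreover, if φ(d,d) ≥ 0 then the weighted adjacency energy satisfies Ė_φ(C_{p,…,p}) = 4(p−1)(t−1)φ(d,d). -/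
open Polynomial Matrix

def crownD (m : ℕ) : Fin (m + 1) → ℝ := fun i => if i = 0 then (m : ℝ) else -1

def crownP (m : ℕ) : Matrix (Fin (m + 1)) (Fin (m + 1)) ℝ :=
  Matrix.of fun i j => if j = 0 then 1 else ((if i = j then 1 else 0) - (if i = 0 then 1 else 0))

noncomputable def crownQ (m : ℕ) : Matrix (Fin (m + 1)) (Fin (m + 1)) ℝ :=
  Matrix.of fun i j => if i = 0 then ((m : ℝ) + 1)⁻¹ else ((if i = j then 1 else 0) - ((m : ℝ) + 1)⁻¹)

def crownM (m : ℕ) : Matrix (Fin (m + 1)) (Fin (m + 1)) ℝ :=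
  Matrix.of fun i j => if i ≠ j then 1 else 0

lemma crownQP (m : ℕ) : crownQ m * crownP m = 1 := by
  have h : (m : ℝ) + 1 ≠ 0 := by positivity
  ext i j
  simp only [crownQ, crownP, Matrix.mul_apply, Matrix.of_apply, Matrix.one_apply]
  by_cases hi : i = 0 <;> by_cases hj : j = 0
  · simp [hi, hj, h]
  · simp [hi, hj, mul_sub, Ne.symm hj]
  · simp [hi, hj, h]
  · simp [hi, hj, mul_sub]

lemma crownMP (m : ℕ) : crownM m * crownP m = crownP m * Matrix.diagonal (crownD m) := by
  have hM : crownM m = Matrix.of (fun _ _ => (1 : ℝ)) - 1 := by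
    ext i j
    by_cases h : i = j <;> simp [crownM, h]
  ext i j
  rw [hM, Matrix.sub_mul, Matrix.one_mul, Matrix.mul_diagonal]
  simp only [crownP, crownD, Matrix.mul_apply, Matrix.of_apply, Matrix.sub_apply]
  by_cases hj : j = 0
  · simp [hj]
  · simp [hj]

lemma crown_charpoly (m n : ℕ) (c : ℝ)
    (A : Matrix (Fin (m + 1) × Fin (n + 1)) (Fin (m + 1) × Fin (n + 1)) ℝ)
    (hA : ∀ u v, A u v = if u.1 ≠ v.1 ∧ u.2 ≠ v.2 then c else 0) :
    A.charpoly = ∏ u : Fin (m + 1) × Fin (n + 1), (X - C (c * (crownD m u.1 * crownD n u.2))) := by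
  have hA' : A = c • Matrix.kronecker (crownM m) (crownM n) := by
    ext u v
    rw [hA]
    by_cases h1 : u.1 = v.1 <;> by_cases h2 : u.2 = v.2 <;>
      simp [crownM, h1, h2, Matrix.kronecker, Matrix.kroneckerMap_apply]
  set P := Matrix.kronecker (crownP m) (crownP n) with hP
  set Q := Matrix.kronecker (crownQ m) (crownQ n) with hQ
  have hQP : Q * P = 1 := by
    rw [hP, hQ]
    simp only [Matrix.kronecker]
    rw [← Matrix.mul_kronecker_mul, crownQP, crownQP,
      Matrix.one_kronecker_one]
  have hPQ : P * Q = 1 := mul_eq_one_comm.mp hQP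
  have hD : A * P = P * Matrix.diagonal (fun u => c * (crownD m u.1 * crownD n u.2)) := by
    have : Matrix.diagonal (fun u : Fin (m + 1) × Fin (n + 1) => c * (crownD m u.1 * crownD n u.2))
        = c • Matrix.kronecker (Matrix.diagonal (crownD m)) (Matrix.diagonal (crownD n)) := by
      rw [Matrix.kronecker, Matrix.diagonal_kronecker_diagonal, ← Matrix.diagonal_smul]
      rfl
    rw [this, hA', Matrix.smul_mul, Matrix.mul_smul, hP]
    simp only [Matrix.kronecker]
    rw [← Matrix.mul_kronecker_mul, ← Matrix.mul_kronecker_mul, crownMP, crownMP]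
  have hE : A = P * Matrix.diagonal (fun u => c * (crownD m u.1 * crownD n u.2)) * Q := by
    rw [← hD, Matrix.mul_assoc, hPQ, Matrix.mul_one]
  have := Matrix.charpoly_units_conj (⟨P, Q, hPQ, hQP⟩ : (Matrix _ _ ℝ)ˣ)
    (Matrix.diagonal (fun u => c * (crownD m u.1 * crownD n u.2)))
  rw [← Matrix.coe_units_inv] at this
  rw [hE]
  refine Eq.trans this ?_
  rw [Matrix.charpoly_diagonal]

/-- For `p ≥ 2`, `t ≥ 2`, the weighted adjacency matrix of the crown
multipartite graph `C_{p,…,p}` (regular of degree `d = (t-1)(p-1)`) has characteristic polynomial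
`(x - φ(d,d))^((t-1)(p-1)) (x + (p-1)φ(d,d))^(t-1) (x + (t-1)φ(d,d))^(p-1)
  (x - (p-1)(t-1)φ(d,d))`, and if `φ(d,d) ≥ 0` its energy equals `4(p-1)(t-1)φ(d,d)`. -/
theorem weighted_charpoly_and_energy_crown_multipartite
    (p t : ℕ) (hp : 2 ≤ p) (ht : 2 ≤ t)
    (φ : ℕ → ℕ → ℝ) (hφ : ∀ x y, φ x y = φ y x)
    (d : ℕ) (hd : d = (t - 1) * (p - 1))
    (A : Matrix (Fin t × Fin p) (Fin t × Fin p) ℝ)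
    (hA : ∀ u v, A u v = if u.1 ≠ v.1 ∧ u.2 ≠ v.2 then φ d d else 0) :
    A.charpoly =
      (X - C (φ d d)) ^ ((t - 1) * (p - 1)) *
        (X + C (((p : ℝ) - 1) * φ d d)) ^ (t - 1) *
        (X + C (((t : ℝ) - 1) * φ d d)) ^ (p - 1) *
        (X - C (((p : ℝ) - 1) * ((t : ℝ) - 1) * φ d d)) ∧
    (0 ≤ φ d d →
      matrixEnergy A = 4 * ((p : ℝ) - 1) * ((t : ℝ) - 1) * φ d d) := by
  obtain ⟨m, rfl⟩ : ∃ m, t = m + 1 := ⟨t - 1, by omega⟩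
  obtain ⟨n, rfl⟩ : ∃ n, p = n + 1 := ⟨p - 1, by omega⟩
  have key := crown_charpoly m n (φ d d) A hA
  generalize φ d d = c at key ⊢
  constructor
  · rw [key, Fintype.prod_prod_type, Fin.prod_univ_succ]
    simp only [Fin.prod_univ_succ, crownD, Fin.succ_ne_zero, if_true, if_false, Finset.prod_const,
      Finset.card_univ, Fintype.card_fin, Nat.add_sub_cancel, mul_pow, ← pow_mul]
    push_cast
    have e1 : c * ((m : ℝ) * (n : ℝ)) = ((n : ℝ) + 1 - 1) * ((m : ℝ) + 1 - 1) * c := by ring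
    have e2 : c * ((m : ℝ) * -1) = - (((m : ℝ) + 1 - 1) * c) := by ring
    have e3 : c * (-1 * (n : ℝ)) = - (((n : ℝ) + 1 - 1) * c) := by ring
    have e4 : c * (-1 * -1) = c := by ring
    rw [e1, e2, e3, e4, C_neg, C_neg, sub_neg_eq_add, sub_neg_eq_add]
    ring
  · intro hc
    have hr : A.charpoly.roots = (Finset.univ : Finset (Fin (m + 1) × Fin (n + 1))).val.map
        (fun u => c * (crownD m u.1 * crownD n u.2)) := by
      rw [key, ← Polynomial.roots_multiset_prod_X_sub_C (Multiset.map _ _), Multiset.map_map]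
      rfl
    have hs : ∀ k : ℕ, ∑ i, |crownD k i| = 2 * (k : ℝ) := by
      intro k
      rw [Fin.sum_univ_succ]
      simp [crownD, Fin.succ_ne_zero]
      ring
    rw [matrixEnergy, hr, Multiset.map_map]
    change ∑ u : Fin (m + 1) × Fin (n + 1), |c * (crownD m u.1 * crownD n u.2)| = _
    simp only [abs_mul, abs_of_nonneg hc]
    rw [← Finset.mul_sum, Fintype.sum_prod_type]
    dsimp only
    rw [← Finset.sum_mul_sum, hs, hs]
    push_cast
    ring
end

section
/- Let p ≥ 2, t ≥ 2, and let C_{p,…,p} be the crown multipartite graph, regular of degree d = (t−1)(p−1). Then the spectrum of the weighted adjacency matrix Ȧ(C_{p,…,p}) is integral (every eigenvalue is an integer) if and only if φ(d,d) is an integer. -/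
open Polynomial Matrix

lemma crown_mulVec (p t : ℕ) (c : ℝ) (A : Matrix (Fin t × Fin p) (Fin t × Fin p) ℝ)
    (hA : ∀ u v, A u v = if u.1 ≠ v.1 ∧ u.2 ≠ v.2 then c else 0)
    (v : Fin t × Fin p → ℝ) (i : Fin t) (k : Fin p) :
    (A *ᵥ v) (i, k) = c * ((∑ j, ∑ l, v (j, l)) - (∑ l, v (i, l)) - (∑ j, v (j, k)) + v (i, k)) := by
  have h : ∀ j l, A (i, k) (j, l) * v (j, l) =
      c * (v (j, l) - (if i = j then v (j, l) else 0) - (if k = l then v (j, l) else 0)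
        + (if i = j then (if k = l then v (j, l) else 0) else 0)) := by
    intro j l
    rw [hA]
    by_cases h1 : i = j <;> by_cases h2 : k = l <;> simp [h1, h2]
  simp only [Matrix.mulVec, dotProduct, Fintype.sum_prod_type, h]
  simp only [← Finset.mul_sum, Finset.sum_add_distrib, Finset.sum_sub_distrib]
  congr 1
  have e1 : ∑ j, ∑ l, (if i = j then v (j, l) else 0) = ∑ l, v (i, l) := by
    rw [Finset.sum_comm]; simp
  have e3 : ∑ j, ∑ l, (if i = j then (if k = l then v (j, l) else 0) else 0) = v (i, k) := by
    rw [Finset.sum_comm]; simp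
  rw [e1, e3]
  simp

lemma crown_mem_spectrum {n : Type*} [Fintype n] [DecidableEq n] (A : Matrix n n ℝ) (μ : ℝ) :
    μ ∈ spectrum ℝ A ↔ ∃ v : n → ℝ, v ≠ 0 ∧ A *ᵥ v = μ • v := by
  rw [← Matrix.spectrum_toLin', ← Module.End.hasEigenvalue_iff_mem_spectrum]
  constructor
  · intro h
    obtain ⟨v, hv⟩ := h.exists_hasEigenvector
    exact ⟨v, hv.2, by simpa using hv.apply_eq_smul⟩
  · rintro ⟨v, h0, hv⟩
    exact Module.End.hasEigenvalue_of_hasEigenvector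
      (x := v) ⟨Module.End.mem_eigenspace_iff.2 (by simpa using hv), h0⟩

/-- For `p ≥ 2`, `t ≥ 2`, the spectrum of the weighted adjacency matrix of the
crown multipartite graph `C_{p,…,p}` (regular of degree `d = (t-1)(p-1)`) is integral if and
only if `φ(d,d)` is an integer. -/
theorem weighted_spectrum_crown_multipartite_integral_iff
    (p t : ℕ) (hp : 2 ≤ p) (ht : 2 ≤ t)
    (φ : ℕ → ℕ → ℝ) (hφ : ∀ x y, φ x y = φ y x)
    (d : ℕ) (hd : d = (t - 1) * (p - 1))
    (A : Matrix (Fin t × Fin p) (Fin t × Fin p) ℝ)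
    (hA : ∀ u v, A u v = if u.1 ≠ v.1 ∧ u.2 ≠ v.2 then φ d d else 0) :
    (∀ μ ∈ spectrum ℝ A, ∃ z : ℤ, μ = (z : ℝ)) ↔ ∃ z : ℤ, φ d d = (z : ℝ) := by
  have key := crown_mulVec p t (φ d d) A hA
  generalize φ d d = c at *
  constructor
  · intro h
    apply h
    rw [crown_mem_spectrum]
    have aux : ∀ n : ℕ, 2 ≤ n → ∃ x : Fin n → ℝ, x ≠ 0 ∧ ∑ i, x i = 0 := by
      intro n hn
      have hne : (⟨0, by omega⟩ : Fin n) ≠ ⟨1, by omega⟩ := by simp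
      refine ⟨Pi.single ⟨0, by omega⟩ 1 - Pi.single ⟨1, by omega⟩ 1, ?_, by simp⟩
      intro h0
      have := congrFun h0 ⟨0, by omega⟩
      simp [Pi.single_apply] at this
    obtain ⟨x, hx, sx⟩ := aux t ht
    obtain ⟨y, hy, sy⟩ := aux p hp
    obtain ⟨i, hi⟩ := Function.ne_iff.1 hx
    obtain ⟨k, hk⟩ := Function.ne_iff.1 hy
    refine ⟨fun u => x u.1 * y u.2, ?_, ?_⟩
    · intro h0
      have := congrFun h0 (i, k)
      exact mul_ne_zero hi hk this
    · ext ⟨i, k⟩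
      rw [key]
      simp [← Finset.mul_sum, ← Finset.sum_mul, sx, sy]
  · rintro ⟨z, rfl⟩ μ hμ
    rw [crown_mem_spectrum] at hμ
    obtain ⟨v, hv0, hv⟩ := hμ
    have e : ∀ i k, (z : ℝ) * ((∑ j, ∑ l, v (j, l)) - (∑ l, v (i, l)) - (∑ j, v (j, k)) + v (i, k))
        = μ * v (i, k) := by
      intro i k
      rw [← key, hv]; simp
    have hcomm : ∑ l, ∑ j, v (j, l) = ∑ j, ∑ l, v (j, l) := Finset.sum_comm
    have eR : ∀ i, (z : ℝ) * (p * (∑ j, ∑ l, v (j, l)) - p * (∑ l, v (i, l))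
        - (∑ j, ∑ l, v (j, l)) + ∑ l, v (i, l)) = μ * ∑ l, v (i, l) := by
      intro i
      have := Finset.sum_congr (rfl : (Finset.univ : Finset (Fin p)) = _) fun k _ => e i k
      simpa [← Finset.mul_sum, Finset.sum_add_distrib, Finset.sum_sub_distrib, hcomm] using this
    have eC : ∀ k, (z : ℝ) * (t * (∑ j, ∑ l, v (j, l)) - (∑ j, ∑ l, v (j, l))
        - t * (∑ j, v (j, k)) + ∑ j, v (j, k)) = μ * ∑ j, v (j, k) := by
      intro k
      have := Finset.sum_congr (rfl : (Finset.univ : Finset (Fin t)) = _) fun i _ => e i k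
      simpa [← Finset.mul_sum, Finset.sum_add_distrib, Finset.sum_sub_distrib] using this
    have eS : (z : ℝ) * (t * (p * (∑ j, ∑ l, v (j, l))) - p * (∑ j, ∑ l, v (j, l))
        - t * (∑ j, ∑ l, v (j, l)) + ∑ j, ∑ l, v (j, l)) = μ * ∑ j, ∑ l, v (j, l) := by
      have := Finset.sum_congr (rfl : (Finset.univ : Finset (Fin t)) = _) fun i _ => eR i
      simpa [← Finset.mul_sum, Finset.sum_add_distrib, Finset.sum_sub_distrib] using this
    generalize hS : (∑ j, ∑ l, v (j, l)) = S at *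
    by_cases h0 : S = 0
    · by_cases hR : ∀ i, ∑ l, v (i, l) = 0
      · by_cases hC : ∀ k, ∑ j, v (j, k) = 0
        · obtain ⟨⟨i, k⟩, hik⟩ := Function.ne_iff.1 hv0
          refine ⟨z, mul_right_cancel₀ (b := v (i, k)) hik ?_⟩
          have := e i k
          rw [hR, hC, h0] at this
          linarith
        · push Not at hC
          obtain ⟨k, hk⟩ := hC
          refine ⟨z * (1 - t), mul_right_cancel₀ hk ?_⟩
          have := eC k
          rw [h0] at this
          push_cast
          linarith
      · push Not at hR
        obtain ⟨k, hk⟩ := hR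
        refine ⟨z * (1 - p), mul_right_cancel₀ hk ?_⟩
        have := eR k
        rw [h0] at this
        push_cast
        linarith
    · refine ⟨z * (t - 1) * (p - 1), mul_right_cancel₀ h0 ?_⟩
      push_cast
      linarith
end
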